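/- Every caterpillar S with at least 17 vertices that is neither a star nor a path has inducibility at most 1 - 10^{-4}. -/

import Mathlib

open SimpleGraph Filter

/-- The degree of a vertex, as the cardinality of its neighbour set. -/
noncomputable def ndeg {V : Type*} (G : SimpleGraph V) (v : V) : ℕ :=
  (G.neighborSet v).ncard

/-- `Z_k(G)`: the number of `k`-vertex subtrees (connected subgraphs) of `G`. -/
noncomputable def subtreeCount {V : Type*} [Fintype V] (G : SimpleGraph V) (k : ℕ) : ℕ :=
  {s : Finset V | s.card = k ∧ (G.induce (s : Set V)).Connected}.ncard

/-- The number of embeddings (subtrees isomorphic to `S`) of a tree `S` in `G`,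
counted among `k`-vertex subtrees. -/
noncomputable def embCount {V W : Type*} [Fintype V] (G : SimpleGraph V)
    (S : SimpleGraph W) (k : ℕ) : ℕ :=
  {s : Finset V | s.card = k ∧ Nonempty ((G.induce (s : Set V)) ≃g S)}.ncard

/-- The density `d(S,T)`: the number of embeddings of the `|S|`-vertex tree `S` in `T`
divided by the number of `|S|`-vertex subtrees of `T` (`0` if `T` has fewer vertices). -/
noncomputable def density {V W : Type*} [Fintype V] [Fintype W]
    (S : SimpleGraph W) (T : SimpleGraph V) : ℝ :=
  (embCount T S (Fintype.card W) : ℝ) / (subtreeCount T (Fintype.card W) : ℝ)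

/-- `max { d(S,T) : T an n-vertex tree }`. -/
noncomputable def maxDensity {W : Type*} [Fintype W] (S : SimpleGraph W) (n : ℕ) : ℝ :=
  sSup {x : ℝ | ∃ T : SimpleGraph (Fin n), T.IsTree ∧ x = density S T}

/-- The inducibility of `S`: `limsup_{n → ∞} max { d(S,T) : T an n-vertex tree }`. -/
noncomputable def inducibility {W : Type*} [Fintype W] (S : SimpleGraph W) : ℝ :=
  Filter.limsup (maxDensity S) Filter.atTop

/-- A graph is starlike if it has at most one non-leaf vertex. -/
def IsStarlike {V : Type*} (G : SimpleGraph V) : Prop :=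
  {v | ndeg G v ≠ 1}.Subsingleton

/-- A graph is pathlike if its maximum degree is at most 2. -/
def IsPathlike {V : Type*} (G : SimpleGraph V) : Prop :=
  ∀ v, ndeg G v ≤ 2

/-- The vertex set of the component of `u` in `G - v`; together with the edge `uv`, this is
the branch of `G` rooted at `v` through its neighbour `u`. -/
def branchSet {V : Type*} (G : SimpleGraph V) (v u : V) : Set V :=
  {w | ∃ p : G.Walk u w, v ∉ p.support}

/-- The branch of `G` rooted at `v` through `u` is non-trivial if it is not a single edge. -/
def NontrivialBranch {V : Type*} (G : SimpleGraph V) (v u : V) : Prop :=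
  G.Adj v u ∧ branchSet G v u ≠ {u}

/-- The branch rooted at `v` through `u` is a fork: non-trivial and isomorphic to a star in
which `v` is a leaf (all vertices of the branch other than `u` and `v` are leaves of `G`). -/
def IsFork {V : Type*} (G : SimpleGraph V) (v u : V) : Prop :=
  NontrivialBranch G v u ∧ ∀ w ∈ branchSet G v u, w ≠ u → ndeg G w = 1

/-- The order of a fork: its number of leaves other than the root. -/
noncomputable def forkOrder {V : Type*} (G : SimpleGraph V) (v u : V) : ℕ :=
  (branchSet G v u).ncard - 1

/-- A branch is major if it is non-trivial and not a fork. -/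
def IsMajor {V : Type*} (G : SimpleGraph V) (v u : V) : Prop :=
  NontrivialBranch G v u ∧ ¬ IsFork G v u

/-- A caterpillar is a tree in which every vertex is the root of at most two
non-trivial branches. -/
def IsCaterpillar {V : Type*} (G : SimpleGraph V) : Prop :=
  G.IsTree ∧ ∀ v, {u | NontrivialBranch G v u}.ncard ≤ 2

/-- A center of `G`: each branch rooted at `v` has at most `|G|/2` edges (the branch through
a neighbour `u` has `(branchSet G v u).ncard` edges). -/
def IsCenter {V : Type*} [Fintype V] (G : SimpleGraph V) (v : V) : Prop :=
  ∀ u, G.Adj v u → 2 * (branchSet G v u).ncard ≤ Fintype.card V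

/-- `v` is the root of at least three non-trivial branches. -/
def RootsThreeNontrivial {V : Type*} (G : SimpleGraph V) (v : V) : Prop :=
  3 ≤ {u | NontrivialBranch G v u}.ncard

/-- A hub of `G`: a vertex `v` that is the only vertex on the path from `v` to the nearest
center of `G` that is the root of at least three non-trivial branches.  (A vertex `w` lies on
the path from `v` to `c` iff `dist v w + dist w c = dist v c`.) -/
def IsHub {V : Type*} [Fintype V] (G : SimpleGraph V) (v : V) : Prop :=
  RootsThreeNontrivial G v ∧
  ∃ c, IsCenter G c ∧ (∀ c', IsCenter G c' → G.dist v c ≤ G.dist v c') ∧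
    ∀ w, G.dist v w + G.dist w c = G.dist v c → w ≠ v → ¬ RootsThreeNontrivial G w

/-- The product of the binomial coefficients `D i` choose `a i`. -/
def chooseProd {ι : Type*} [Fintype ι] (D a : ι → ℕ) : ℕ := ∏ i, (D i).choose (a i)

theorem chooseProd_split {ι : Type*} [Fintype ι] [DecidableEq ι] (D a : ι → ℕ) (i : ι) :
    chooseProd D a = (D i).choose (a i) * ∏ j ∈ Finset.univ.erase i, (D j).choose (a j) :=
  (Finset.mul_prod_erase _ (fun j => (D j).choose (a j)) (Finset.mem_univ i)).symm

theorem chooseProd_pos {ι : Type*} [Fintype ι] {D a : ι → ℕ} (h : ∀ i, a i ≤ D i) :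
    0 < chooseProd D a :=
  Finset.prod_pos fun i _ => Nat.choose_pos (h i)

theorem chooseProd_add_single {ι : Type*} [Fintype ι] [DecidableEq ι] (D b : ι → ℕ) (i : ι) :
    chooseProd D (b + Pi.single i 1) * (b i + 1) = chooseProd D b * (D i - b i) := by
  rw [chooseProd_split D _ i, chooseProd_split D b i]
  have : ∏ j ∈ Finset.univ.erase i, (D j).choose ((b + Pi.single i 1 : ι → ℕ) j)
      = ∏ j ∈ Finset.univ.erase i, (D j).choose (b j) :=
    Finset.prod_congr rfl fun j hj => by simp [Finset.ne_of_mem_erase hj]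
  rw [this]
  have h := Nat.choose_succ_right_eq (D i) (b i)
  simp only [Pi.add_apply, Pi.single_eq_same]
  linear_combination (∏ j ∈ Finset.univ.erase i, (D j).choose (b j)) * h

theorem chooseProd_sub_single {ι : Type*} [Fintype ι] [DecidableEq ι] (D b : ι → ℕ) (i : ι) :
    chooseProd (D - Pi.single i 1) b * D i = chooseProd D b * (D i - b i) := by
  rw [chooseProd_split _ b i, chooseProd_split D b i]
  have : ∏ j ∈ Finset.univ.erase i, ((D - Pi.single i 1 : ι → ℕ) j).choose (b j)
      = ∏ j ∈ Finset.univ.erase i, (D j).choose (b j) :=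
    Finset.prod_congr rfl fun j hj => by simp [Finset.ne_of_mem_erase hj]
  rw [this]
  have h : (D i - 1).choose (b i) * D i = (D i).choose (b i) * (D i - b i) := by
    rcases hD : D i with _ | n
    · simp
    · exact Nat.choose_mul_succ_eq n (b i)
  simp only [Pi.sub_apply, Pi.single_eq_same]
  linear_combination (∏ j ∈ Finset.univ.erase i, (D j).choose (b j)) * h

theorem le_mul_of_mul_eq_mul {x y α β K : ℕ} (h : x * α = y * β) (hα : 0 < α)
    (hβ : β ≤ K * α) : x ≤ K * y := by
  refine Nat.le_of_mul_le_mul_right ?_ hα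
  calc x * α = y * β := h
    _ ≤ y * (K * α) := Nat.mul_le_mul_left _ hβ
    _ = K * y * α := by ring

theorem exists_eq_add_single {ι : Type*} [DecidableEq ι] {a : ι → ℕ} {p : ι} (h : 1 ≤ a p) :
    ∃ b : ι → ℕ, a = b + Pi.single p 1 := by
  refine ⟨a - Pi.single p 1, funext fun i => ?_⟩
  by_cases hi : i = p
  · subst hi; simp; omega
  · simp [hi]

theorem sum_add_single {ι : Type*} [Fintype ι] [DecidableEq ι] (b : ι → ℕ) (p : ι) :
    ∑ i, (b + Pi.single p 1 : ι → ℕ) i = ∑ i, b i + 1 := by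
  simp [Finset.sum_add_distrib]

theorem sum_sq_add_single {ι : Type*} [Fintype ι] [DecidableEq ι] (b h : ι → ℕ) (p : ι) :
    ∑ i, ((b + Pi.single p 1 : ι → ℕ) i + h i) ^ 2
      = ∑ i, (b i + h i) ^ 2 + 2 * (b p + h p) + 1 := by
  rw [← Finset.add_sum_erase _ _ (Finset.mem_univ p),
    ← Finset.add_sum_erase _ (fun i => (b i + h i) ^ 2) (Finset.mem_univ p)]
  have : ∑ i ∈ Finset.univ.erase p, ((b + Pi.single p 1 : ι → ℕ) i + h i) ^ 2
      = ∑ i ∈ Finset.univ.erase p, (b i + h i) ^ 2 :=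
    Finset.sum_congr rfl fun j hj => by simp [Finset.ne_of_mem_erase hj]
  rw [this]; simp; ring

/-- Moving one unit from `p` to `q`. -/
theorem chooseProd_move {ι : Type*} [Fintype ι] [DecidableEq ι] (D b : ι → ℕ) (p q : ι) {K : ℕ}
    (hpos : 0 < (b p + 1) * (D q - b q))
    (hK : (b q + 1) * (D p - b p) ≤ K * ((b p + 1) * (D q - b q))) :
    chooseProd D (b + Pi.single p 1) ≤ K * chooseProd D (b + Pi.single q 1) := by
  refine le_mul_of_mul_eq_mul (α := (b p + 1) * (D q - b q)) (β := (b q + 1) * (D p - b p)) ?_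
    hpos hK
  have h1 := chooseProd_add_single D b p
  have h2 := chooseProd_add_single D b q
  linear_combination (D q - b q) * h1 - (D p - b p) * h2

/-- The leaf vector `a` can be exchanged for one with the same sum but a different degree
sequence, losing at most a factor `K`. -/
def HasSwap {ι : Type*} [Fintype ι] (K : ℕ) (h D a : ι → ℕ) : Prop :=
  ∃ b : ι → ℕ, ∑ i, b i = ∑ i, a i ∧ ∑ i, (b i + h i) ^ 2 ≠ ∑ i, (a i + h i) ^ 2 ∧
    (∀ i, 2 ≤ b i + h i) ∧ chooseProd D a ≤ K * chooseProd D b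

/-- Two units of the leaf vector `a` can be exchanged for a path of length two attached at `t`,
losing at most a factor `K`. -/
def HasStretch {ι : Type*} [Fintype ι] [DecidableEq ι] (K : ℕ) (h D a : ι → ℕ) (t : ι) : Prop :=
  ∃ a' : ι → ℕ, ∑ i, a' i + 2 = ∑ i, a i ∧ (∀ i, i ≠ t → 2 ≤ a' i + h i) ∧
    chooseProd D a ≤ K * chooseProd (D - Pi.single t 1) a'

theorem HasSwap.mono {ι : Type*} [Fintype ι] {K K' : ℕ} {h D a : ι → ℕ} (hK : K ≤ K')
    (H : HasSwap K h D a) : HasSwap K' h D a := by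
  obtain ⟨a', h1, h2, h3, h4⟩ := H
  exact ⟨a', h1, h2, h3, h4.trans (Nat.mul_le_mul_right _ hK)⟩

theorem hasSwap_single {ι : Type*} [Fintype ι] [DecidableEq ι] {K : ℕ} {h a e : ι → ℕ} {p q : ι}
    (hh : ∀ i, h i ≤ 2) (ha : ∀ i, 2 ≤ a i + h i) (hpq : p ≠ q) (hp : 3 ≤ a p + h p)
    (hd : a p + h p ≠ a q + h q + 1) (hq : 1 ≤ e q)
    (hK : (a q + 1) * (e p + 1) ≤ K * (a p * e q)) : HasSwap K h (a + e) a := by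
  obtain ⟨b, rfl⟩ := exists_eq_add_single (a := a) (p := p) (by have := hh p; omega)
  simp only [Pi.add_apply, Pi.single_eq_same, Pi.single_eq_of_ne hpq.symm, add_zero] at *
  refine ⟨b + Pi.single q 1, ?_, ?_, ?_, ?_⟩
  · simp only [Pi.add_apply, Finset.sum_add_distrib]; simp
  · have h1 := sum_sq_add_single b h p
    have h2 := sum_sq_add_single b h q
    simp only [Pi.add_apply] at h1 h2 ⊢
    omega
  · intro i
    by_cases hi : i = p
    · subst hi; simp [hpq]; omega
    · have := ha i; simp [hi] at this; simp; omega
  · have e1 : (b + Pi.single p 1 + e : ι → ℕ) p - b p = e p + 1 := by simp; omega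
    have e2 : (b + Pi.single p 1 + e : ι → ℕ) q - b q = e q := by simp [hpq.symm]
    refine chooseProd_move _ b p q ?_ ?_
    · rw [e2]; positivity
    · rw [e1, e2]; exact hK

theorem hasSwap_pair {ι : Type*} [Fintype ι] [DecidableEq ι] {h a e : ι → ℕ} {p p' q : ι}
    (hh : ∀ i, h i ≤ 2) (ha : ∀ i, 2 ≤ a i + h i) (hpp : p ≠ p') (hpq : p ≠ q) (hpq' : p' ≠ q)
    (hp : 3 ≤ a p + h p) (hp' : 3 ≤ a p' + h p')
    (hd : a p + h p = a q + h q + 1) (hd' : a p' + h p' = a q + h q + 1) (hq : 2 ≤ e q)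
    (hK : (a q + 1) * (e p + 1) ≤ 4 * (a p * e q))
    (hK' : (a q + 1) * (e p' + 1) ≤ 4 * (a p' * e q)) : HasSwap 256 h (a + e) a := by
  obtain ⟨c, rfl⟩ := exists_eq_add_single (a := a) (p := p) (by have := hh p; omega)
  obtain ⟨b, rfl⟩ := exists_eq_add_single (a := c) (p := p')
    (by have := hh p'; simp [hpp.symm] at hp'; omega)
  simp only [Pi.add_apply, Pi.single_eq_same, Pi.single_eq_of_ne hpq.symm,
    Pi.single_eq_of_ne hpp.symm, Pi.single_eq_of_ne hpp, Pi.single_eq_of_ne hpq'.symm,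
    add_zero] at *
  refine ⟨b + Pi.single q 1 + Pi.single q 1, ?_, ?_, ?_, ?_⟩
  · simp only [Pi.add_apply, Finset.sum_add_distrib]; simp
  · have h1 := sum_sq_add_single b h p'
    have h2 := sum_sq_add_single (b + Pi.single p' 1) h p
    have h3 := sum_sq_add_single b h q
    have h4 := sum_sq_add_single (b + Pi.single q 1) h q
    simp only [Pi.add_apply, Pi.single_eq_same, Pi.single_eq_of_ne hpp, add_zero] at *
    omega
  · intro i
    by_cases hi : i = p
    · subst hi; simp [hpq]; omega
    · by_cases hi' : i = p'
      · subst hi'; simp [hpq']; omega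
      · have := ha i; simp [hi, hi'] at this; simp; omega
  · set D : ι → ℕ := b + Pi.single p' 1 + Pi.single p 1 + e with hD
    have d1 : D p = b p + 1 + e p := by simp [hD, hpp]
    have d2 : D p' = b p' + 1 + e p' := by simp [hD, hpp.symm]
    have d3 : D q = b q + e q := by simp [hD, hpq.symm, hpq'.symm]
    have s1 : chooseProd D (b + Pi.single p' 1 + Pi.single p 1)
        ≤ 4 * chooseProd D (b + Pi.single p' 1 + Pi.single q 1) := by
      refine chooseProd_move D (b + Pi.single p' 1) p q ?_ ?_
      · simp only [Pi.add_apply, Pi.single_eq_of_ne hpq'.symm, d3]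
        rw [add_zero, Nat.add_sub_cancel_left]; positivity
      · simp only [Pi.add_apply, Pi.single_eq_of_ne hpq'.symm, Pi.single_eq_of_ne hpp, d3, d1]
        rw [add_zero, add_zero, Nat.add_sub_cancel_left]
        rwa [show b p + 1 + e p - b p = e p + 1 by omega]
    have s2 : chooseProd D (b + Pi.single q 1 + Pi.single p' 1)
        ≤ 64 * chooseProd D (b + Pi.single q 1 + Pi.single q 1) := by
      refine chooseProd_move D (b + Pi.single q 1) p' q ?_ ?_
      · simp only [Pi.add_apply, Pi.single_eq_same, d3]
        have : 0 < b q + e q - (b q + 1) := by omega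
        positivity
      · simp only [Pi.add_apply, Pi.single_eq_same, Pi.single_eq_of_ne hpq', d3, d2]
        rw [add_zero, show b q + e q - (b q + 1) = e q - 1 by omega,
          show b p' + 1 + e p' - b p' = e p' + 1 by omega]
        have : e q ≤ 2 * (e q - 1) := by omega
        calc (b q + 1 + 1) * (e p' + 1) ≤ 2 * ((b q + 1) * (e p' + 1)) := by nlinarith
          _ ≤ 2 * (4 * ((b p' + 1) * e q)) := by omega
          _ ≤ 2 * (4 * ((b p' + 1) * (2 * (e q - 1)))) := by gcongr
          _ ≤ 64 * ((b p' + 1) * (e q - 1)) := by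
            rw [show 2 * (4 * ((b p' + 1) * (2 * (e q - 1)))) = 16 * ((b p' + 1) * (e q - 1)) by
              ring]
            omega
    rw [show b + Pi.single q 1 + Pi.single p' 1 = b + Pi.single p' 1 + Pi.single q 1 by
      abel] at s2
    omega

theorem hasSwap_double {ι : Type*} [Fintype ι] [DecidableEq ι] {h a e : ι → ℕ} {p q : ι}
    (hh : ∀ i, h i ≤ 2) (ha : ∀ i, 2 ≤ a i + h i) (hpq : p ≠ q) (hp : 4 ≤ a p + h p)
    (hd : a p + h p = a q + h q + 1) (hq : 2 ≤ e q)
    (hK : (a q + 1) * (e p + 1) ≤ 4 * (a p * e q)) : HasSwap 256 h (a + e) a := by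
  obtain ⟨c, rfl⟩ := exists_eq_add_single (a := a) (p := p) (by have := hh p; omega)
  obtain ⟨b, rfl⟩ := exists_eq_add_single (a := c) (p := p)
    (by have := hh p; simp at hp; omega)
  simp only [Pi.add_apply, Pi.single_eq_same, Pi.single_eq_of_ne hpq.symm, add_zero] at *
  refine ⟨b + Pi.single q 1 + Pi.single q 1, ?_, ?_, ?_, ?_⟩
  · simp only [Pi.add_apply, Finset.sum_add_distrib]; simp
  · have h1 := sum_sq_add_single b h p
    have h2 := sum_sq_add_single (b + Pi.single p 1) h p
    have h3 := sum_sq_add_single b h q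
    have h4 := sum_sq_add_single (b + Pi.single q 1) h q
    simp only [Pi.add_apply, Pi.single_eq_same] at *
    omega
  · intro i
    by_cases hi : i = p
    · subst hi; simp [hpq]; omega
    · have := ha i; simp [hi] at this; simp; omega
  · set D : ι → ℕ := b + Pi.single p 1 + Pi.single p 1 + e with hD
    have d1 : D p = b p + 2 + e p := by simp [hD]
    have d3 : D q = b q + e q := by simp [hD, hpq.symm]
    have s1 : chooseProd D (b + Pi.single p 1 + Pi.single p 1)
        ≤ 4 * chooseProd D (b + Pi.single p 1 + Pi.single q 1) := by
      refine chooseProd_move D (b + Pi.single p 1) p q ?_ ?_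
      · simp only [Pi.add_apply, Pi.single_eq_of_ne hpq.symm, d3]
        rw [add_zero, Nat.add_sub_cancel_left]; positivity
      · simp only [Pi.add_apply, Pi.single_eq_of_ne hpq.symm, Pi.single_eq_same, d3, d1]
        rw [add_zero, Nat.add_sub_cancel_left]
        rwa [show b p + 2 + e p - (b p + 1) = e p + 1 by omega]
    have s2 : chooseProd D (b + Pi.single q 1 + Pi.single p 1)
        ≤ 64 * chooseProd D (b + Pi.single q 1 + Pi.single q 1) := by
      refine chooseProd_move D (b + Pi.single q 1) p q ?_ ?_
      · simp only [Pi.add_apply, Pi.single_eq_same, d3]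
        have : 0 < b q + e q - (b q + 1) := by omega
        positivity
      · simp only [Pi.add_apply, Pi.single_eq_same, Pi.single_eq_of_ne hpq, d3, d1]
        rw [add_zero, show b q + e q - (b q + 1) = e q - 1 by omega,
          show b p + 2 + e p - b p = e p + 2 by omega]
        have : e q ≤ 2 * (e q - 1) := by omega
        calc (b q + 1 + 1) * (e p + 2) ≤ 4 * ((b q + 1) * (e p + 1)) := by nlinarith
          _ ≤ 4 * (4 * ((b p + 1 + 1) * e q)) := by omega
          _ ≤ 4 * (4 * ((2 * (b p + 1)) * (2 * (e q - 1)))) := by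
            gcongr; omega
          _ = 64 * ((b p + 1) * (e q - 1)) := by ring
    rw [show b + Pi.single q 1 + Pi.single p 1 = b + Pi.single p 1 + Pi.single q 1 by
      abel] at s2
    omega

theorem hasStretch_ne {ι : Type*} [Fintype ι] [DecidableEq ι] {K : ℕ} {h a e : ι → ℕ} {p t : ι}
    (ha : ∀ i, 2 ≤ a i + h i) (hpt : p ≠ t) (hp : 3 ≤ a p + h p) (hap : 1 ≤ a p)
    (hat : 1 ≤ a t) (hK : (a t + e t) * (e p + 1) ≤ K * (a t * a p)) :
    HasStretch K h (a + e) a t := by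
  obtain ⟨c, rfl⟩ := exists_eq_add_single hap
  obtain ⟨b, rfl⟩ := exists_eq_add_single (a := c) (p := t) (by simpa [hpt.symm] using hat)
  simp only [Pi.add_apply, Pi.single_eq_same, Pi.single_eq_of_ne hpt.symm,
    Pi.single_eq_of_ne hpt, add_zero] at *
  refine ⟨b, ?_, ?_, ?_⟩
  · rw [sum_add_single, sum_add_single]
  · intro i hit
    by_cases hi : i = p
    · subst hi; omega
    · have := ha i; simp [hi, hit] at this; exact this
  · set D : ι → ℕ := b + Pi.single t 1 + Pi.single p 1 + e with hD
    have dt : D t = b t + 1 + e t := by simp [hD, hpt.symm]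
    have h1 := chooseProd_add_single D (b + Pi.single t 1) p
    have h2 := chooseProd_add_single D b t
    have h3 := chooseProd_sub_single D b t
    have dp : D p - (b + Pi.single t 1 : ι → ℕ) p = e p + 1 := by simp [hD, hpt]; omega
    rw [dp] at h1
    simp only [Pi.add_apply, Pi.single_eq_of_ne hpt, add_zero] at h1
    rw [← dt] at hK
    refine le_mul_of_mul_eq_mul (α := (b t + 1) * (b p + 1)) (β := D t * (e p + 1)) ?_
      (by positivity) hK
    linear_combination (b t + 1) * h1 + (e p + 1) * h2 - (e p + 1) * h3

theorem hasStretch_same {ι : Type*} [Fintype ι] [DecidableEq ι] {K : ℕ} {h a e : ι → ℕ} {t : ι}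
    (ha : ∀ i, 2 ≤ a i + h i) (hat : 2 ≤ a t)
    (hK : (a t + e t) * (e t + 1) ≤ K * (a t * (a t - 1))) :
    HasStretch K h (a + e) a t := by
  obtain ⟨c, rfl⟩ := exists_eq_add_single (a := a) (p := t) (by omega)
  obtain ⟨b, rfl⟩ := exists_eq_add_single (a := c) (p := t) (by simp at hat; omega)
  simp only [Pi.add_apply, Pi.single_eq_same] at *
  refine ⟨b, ?_, ?_, ?_⟩
  · rw [sum_add_single, sum_add_single]
  · intro i hit
    have := ha i; simp [hit] at this; exact this
  · set D : ι → ℕ := b + Pi.single t 1 + Pi.single t 1 + e with hD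
    have dt : D t = b t + 1 + 1 + e t := by simp [hD]
    have h1 := chooseProd_add_single D (b + Pi.single t 1) t
    have h2 := chooseProd_add_single D b t
    have h3 := chooseProd_sub_single D b t
    have dp : D t - (b + Pi.single t 1 : ι → ℕ) t = e t + 1 := by simp [hD]; omega
    rw [dp] at h1
    simp only [Pi.add_apply, Pi.single_eq_same] at h1
    rw [← dt, Nat.add_sub_cancel] at hK
    refine le_mul_of_mul_eq_mul (α := (b t + 1 + 1) * (b t + 1)) (β := D t * (e t + 1)) ?_
      (by positivity) hK
    linear_combination (b t + 1) * h1 + (e t + 1) * h2 - (e t + 1) * h3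

theorem hasStretch_two {ι : Type*} [Fintype ι] [DecidableEq ι] {K : ℕ} {h a e : ι → ℕ}
    {p p' t : ι} (ha : ∀ i, 2 ≤ a i + h i) (hpp : p ≠ p') (hpt : p ≠ t) (hpt' : p' ≠ t)
    (hp : 3 ≤ a p + h p) (hp' : 3 ≤ a p' + h p') (hap : 1 ≤ a p) (hap' : 1 ≤ a p')
    (hat : a t = 0) (het : 1 ≤ e t) (hK : (e p + 1) * (e p' + 1) ≤ K * (a p * a p')) :
    HasStretch K h (a + e) a t := by
  obtain ⟨c, rfl⟩ := exists_eq_add_single (a := a) (p := p) hap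
  obtain ⟨b, rfl⟩ := exists_eq_add_single (a := c) (p := p') (by simpa [hpp.symm] using hap')
  simp only [Pi.add_apply, Pi.single_eq_same, Pi.single_eq_of_ne hpt.symm,
    Pi.single_eq_of_ne hpt'.symm, Pi.single_eq_of_ne hpp, Pi.single_eq_of_ne hpp.symm,
    add_zero] at *
  refine ⟨b, ?_, ?_, ?_⟩
  · rw [sum_add_single, sum_add_single]
  · intro i hit
    by_cases hi : i = p
    · subst hi; omega
    · by_cases hi' : i = p'
      · subst hi'; omega
      · have := ha i; simp [hi, hi'] at this; exact this
  · set D : ι → ℕ := b + Pi.single p' 1 + Pi.single p 1 + e with hD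
    have dt : D t = e t := by simp [hD, hpt.symm, hpt'.symm, hat]
    have h1 := chooseProd_add_single D (b + Pi.single p' 1) p
    have h2 := chooseProd_add_single D b p'
    have h3 := chooseProd_sub_single D b t
    have dp : D p - (b + Pi.single p' 1 : ι → ℕ) p = e p + 1 := by simp [hD, hpp]; omega
    have dp' : D p' - b p' = e p' + 1 := by simp [hD, hpp.symm]; omega
    rw [dp] at h1
    rw [dp'] at h2
    rw [hat, Nat.sub_zero] at h3
    have h3' := Nat.eq_of_mul_eq_mul_right (by omega) h3
    simp only [Pi.add_apply, Pi.single_eq_of_ne hpp, add_zero] at h1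
    rw [h3']
    refine le_mul_of_mul_eq_mul (α := (b p + 1) * (b p' + 1)) (β := (e p + 1) * (e p' + 1)) ?_
      (by positivity) hK
    linear_combination (b p' + 1) * h1 + (e p + 1) * h2

theorem exists_max_ratio {ι : Type*} [Fintype ι] (a e : ι → ℕ) (hne : ¬ ∀ i, e i = 0) :
    ∃ q, 1 ≤ e q ∧ ∀ i, e i * (a q + 1) ≤ e q * (a i + 1) := by
  push Not at hne
  obtain ⟨j, hj⟩ := hne
  obtain ⟨q, -, hq⟩ := Finset.exists_max_image Finset.univ
    (fun i => (e i : ℚ) / (a i + 1)) ⟨j, Finset.mem_univ j⟩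
  have key : ∀ i, e i * (a q + 1) ≤ e q * (a i + 1) := fun i => by
    have h := hq i (Finset.mem_univ i)
    rw [div_le_div_iff₀ (by positivity) (by positivity)] at h
    exact_mod_cast h
  refine ⟨q, ?_, key⟩
  by_contra h0
  have h1 := key j
  have h2 : e q = 0 := by omega
  rw [h2, zero_mul] at h1
  have : 0 < e j * (a q + 1) := by positivity
  omega

/-- With two removable vertices, either some leaves can be swapped cheaply or there are few
unused neighbours and every neighbour can be stretched. -/
theorem hasSwap_or_hasStretch {ι : Type*} [Fintype ι] [DecidableEq ι] {h a e : ι → ℕ} {p₀ p₁ : ι}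
    (hh1 : ∀ i, 1 ≤ h i) (hh : ∀ i, h i ≤ 2) (ha : ∀ i, 2 ≤ a i + h i) (h01 : p₀ ≠ p₁)
    (h0 : 3 ≤ a p₀ + h p₀) (h1 : 3 ≤ a p₁ + h p₁) :
    HasSwap 256 h (a + e) a ∨ ((∀ i, e i ≤ 5 * a i + 1) ∧
      ∀ t, 1 ≤ a t + e t → HasStretch 256 h (a + e) a t) := by
  have hrem : ∀ t, ∃ p, p ≠ t ∧ 3 ≤ a p + h p := fun t => by
    by_cases ht : p₀ = t
    · exact ⟨p₁, by rintro rfl; exact h01 ht, h1⟩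
    · exact ⟨p₀, ht, h0⟩
  have hpos : ∀ p, 3 ≤ a p + h p → 1 ≤ a p := fun p hp => by have := hh p; omega
  by_cases hZ : ∀ i, e i = 0
  · refine Or.inr ⟨fun i => by simp [hZ i], fun t ht => ?_⟩
    obtain ⟨p, hpt, hp⟩ := hrem t
    have := hpos p hp
    rw [hZ t] at ht
    refine hasStretch_ne ha hpt hp this ht ?_
    rw [hZ, hZ]; nlinarith
  obtain ⟨q, hq, hmax⟩ := exists_max_ratio a e hZ
  have hgood : ∀ p, 3 ≤ a p + h p → 1 ≤ e p → (a q + 1) * (e p + 1) ≤ 4 * (a p * e q) := by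
    intro p hp hep
    have h2 := hmax p
    have := hpos p hp
    nlinarith
  by_cases hA : ∃ p, p ≠ q ∧ 3 ≤ a p + h p ∧ (a q + 1) * (e p + 1) ≤ 4 * (a p * e q) ∧
      a p + h p ≠ a q + h q + 1
  · obtain ⟨p, hpq, hp, hg, hd⟩ := hA
    exact Or.inl ((hasSwap_single hh ha hpq hp hd hq hg).mono (by norm_num))
  push Not at hA
  by_cases hB : ∃ p, p ≠ q ∧ 3 ≤ a p + h p ∧ (a q + 1) * (e p + 1) ≤ 4 * (a p * e q)
  · obtain ⟨p, hpq, hp, hg⟩ := hB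
    have hd := hA p hpq hp hg
    rcases Nat.lt_or_ge 1 (e q) with he | he
    · left
      rcases Nat.lt_or_ge 3 (a p + h p) with hp4 | hp3
      · exact hasSwap_double hh ha hpq hp4 hd he hg
      · obtain ⟨p', hpp, hp'⟩ := hrem p
        have hq1 := hh1 q
        have hpq' : p' ≠ q := by rintro rfl; omega
        have hg' : (a q + 1) * (e p' + 1) ≤ 4 * (a p' * e q) := by
          rcases Nat.eq_zero_or_pos (e p') with h00 | h00
          · have := hpos p' hp'
            rw [h00]; nlinarith
          · exact hgood p' hp' h00
        exact hasSwap_pair hh ha hpp.symm hpq hpq' hp hp' hd (hA p' hpq' hp' hg') he hg hg'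
    · have he1 : e q = 1 := by omega
      have hap := hpos p hp
      rcases Nat.lt_or_ge 2 (a q + h q) with hq3 | hq2
      · have haq := hpos q hq3
        by_cases hC : ∃ i, i ≠ q ∧ 1 ≤ e i
        · left
          obtain ⟨i, hiq, hei⟩ := hC
          rcases Nat.lt_or_ge 2 (a i + h i) with hi3 | hi2
          · have hdi := hA i hiq hi3 (hgood i hi3 hei)
            have := hh q
            have := hh1 i
            refine hasSwap_single hh ha hiq.symm hq3 (by omega) hei ?_
            rw [he1]
            have : a i + 1 ≤ 4 * a q := by omega
            nlinarith
          · have := hmax p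
            have := hh1 i
            refine hasSwap_single hh ha (p := p) (q := i) ?_ hp (by omega) hei ?_
            · rintro rfl; omega
            · have : a i + 1 ≤ 2 := by omega
              have : e p + 1 ≤ 3 * a p := by nlinarith
              nlinarith
        · push Not at hC
          have hC' : ∀ i, i ≠ q → e i = 0 := fun i hi => by have := hC i hi; omega
          refine Or.inr ⟨fun i => ?_, fun t ht => ?_⟩
          · by_cases hi : i = q
            · rw [hi]; omega
            · rw [hC' i hi]; omega
          · by_cases htq : t = q
            · subst htq
              refine hasStretch_ne ha hpq hp hap haq ?_
              rw [hC' p hpq, he1]; nlinarith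
            · refine hasStretch_ne ha (Ne.symm htq) hq3 haq ?_ ?_
              · have := hC' t htq; omega
              · rw [hC' t htq, he1]; nlinarith
      · have haq : a q ≤ 1 := by have := hh1 q; omega
        have hle : ∀ i, e i ≤ a i + 1 := fun i => by
          have := hmax i
          rw [he1] at this; nlinarith
        refine Or.inr ⟨fun i => by have := hle i; omega, fun t ht => ?_⟩
        rcases Nat.eq_zero_or_pos (a t) with hat | hat
        · have := hh t
          have hp0 := hpos _ h0
          have hp1 := hpos _ h1
          refine hasStretch_two ha h01 ?_ ?_ h0 h1 hp0 hp1 hat (by omega) ?_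
          · rintro rfl; omega
          · rintro rfl; omega
          · have := hle p₀
            have := hle p₁
            calc (e p₀ + 1) * (e p₁ + 1) ≤ (3 * a p₀) * (3 * a p₁) := by gcongr <;> omega
              _ ≤ 256 * (a p₀ * a p₁) := by nlinarith
        · obtain ⟨p', hpt, hp'⟩ := hrem t
          have := hpos p' hp'
          refine hasStretch_ne ha hpt hp' this hat ?_
          have := hle p'
          have := hle t
          calc (a t + e t) * (e p' + 1) ≤ (3 * a t) * (3 * a p') := by gcongr <;> omega
            _ ≤ 256 * (a t * a p') := by nlinarith
  · push Not at hB
    obtain ⟨p, hpq, hp⟩ := hrem q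
    have hap := hpos p hp
    have he0 : ∀ i, i ≠ q → 3 ≤ a i + h i → e i = 0 := fun i hi hi3 => by
      by_contra hne
      have := hB i hi hi3
      have := hgood i hi3 (by omega)
      omega
    have hb := hB p hpq hp
    rw [he0 p hpq hp] at hb
    have haq : 4 * e q ≤ a q := by nlinarith
    have hq3 : 3 ≤ a q + h q := by omega
    by_cases hC : ∃ i, i ≠ q ∧ 1 ≤ e i
    · left
      obtain ⟨i, hiq, hei⟩ := hC
      have hi2 : a i + h i = 2 := by
        have := ha i
        by_contra hne
        have := he0 i hiq (by omega)
        omega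
      have := hh1 i
      refine hasSwap_single hh ha hiq.symm hq3 (by omega) hei ?_
      have : a i + 1 ≤ 2 := by omega
      nlinarith
    · push Not at hC
      have hC' : ∀ i, i ≠ q → e i = 0 := fun i hi => by have := hC i hi; omega
      refine Or.inr ⟨fun i => ?_, fun t ht => ?_⟩
      · by_cases hi : i = q
        · rw [hi]; omega
        · rw [hC' i hi]; omega
      · by_cases htq : t = q
        · subst htq
          refine hasStretch_ne ha hpq hp hap (by omega) ?_
          rw [hC' p hpq]; nlinarith
        · refine hasStretch_ne ha (Ne.symm htq) hq3 (by omega) ?_ ?_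
          · have := hC' t htq; omega
          · rw [hC' t htq]; nlinarith

/-- An injective homomorphism from `H` to `G`. -/
structure IsSkel {V ι : Type*} (G : SimpleGraph V) (H : SimpleGraph ι) (p : ι → V) : Prop where
  inj : Function.Injective p
  adj : ∀ i j, H.Adj i j → G.Adj (p i) (p j)

open scoped Classical in
/-- The number of neighbours of `v` in `X`. -/
noncomputable def degIn {V : Type*} (G : SimpleGraph V) (X : Finset V) (v : V) : ℕ :=
  (X.filter (G.Adj v)).card

open scoped Classical in
/-- The neighbours of `p i` outside the range of `p`. -/
noncomputable def offNbrs {V ι : Type*} [Fintype V] (G : SimpleGraph V) (p : ι → V) (i : ι) :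
    Finset V :=
  Finset.univ.filter fun x => G.Adj (p i) x ∧ x ∉ Set.range p

/-- The number of neighbours of `p i` outside the range of `p`. -/
noncomputable def offDeg {V ι : Type*} [Fintype V] (G : SimpleGraph V) (p : ι → V) : ι → ℕ :=
  fun i => (offNbrs G p i).card

open scoped Classical in
/-- The vertex sets consisting of the range of `p` and of `a i` further neighbours of `p i` for
every `i`. -/
noncomputable def leafFamily {V ι : Type*} [Fintype V] (G : SimpleGraph V) (p : ι → V)
    (a : ι → ℕ) : Finset (Finset V) :=
  Finset.univ.filter fun X => (∀ i, p i ∈ X) ∧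
    (∀ x ∈ X, x ∈ Set.range p ∨ ∃ i, x ∈ offNbrs G p i) ∧
    ∀ i, (X ∩ offNbrs G p i).card = a i

section Skeleton

variable {V ι : Type*} {G : SimpleGraph V} {H : SimpleGraph ι} {p : ι → V}

theorem mem_offNbrs [Fintype V] {i : ι} {x : V} :
    x ∈ offNbrs G p i ↔ G.Adj (p i) x ∧ x ∉ Set.range p := by
  simp [offNbrs]

theorem mem_leafFamily [Fintype V] [DecidableEq V] {a : ι → ℕ} {X : Finset V} :
    X ∈ leafFamily G p a ↔ (∀ i, p i ∈ X) ∧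
    (∀ x ∈ X, x ∈ Set.range p ∨ ∃ i, x ∈ offNbrs G p i) ∧
    ∀ i, (X ∩ offNbrs G p i).card = a i := by
  simp only [leafFamily, Finset.mem_filter, Finset.mem_univ, true_and]
  refine and_congr_right fun _ => and_congr_right fun _ => forall_congr' fun i => ?_
  congr!

/-- The homomorphism underlying a skeleton. -/
def IsSkel.toHom (hp : IsSkel G H p) : H →g G := ⟨p, fun {i j} h => hp.adj i j h⟩

theorem IsSkel.exists_isPath (hp : IsSkel G H p) (hH : H.Preconnected) (i j : ι) :
    ∃ w : G.Walk (p i) (p j), w.IsPath ∧ (∀ x ∈ w.support, x ∈ Set.range p) ∧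
      (w.length = 0 → i = j) ∧ (w.length = 1 → H.Adj i j) := by
  obtain ⟨w, hw⟩ := (hH i j).exists_isPath
  refine ⟨w.map hp.toHom, hw.map hp.inj, fun x hx => ?_, fun h => ?_, fun h => ?_⟩
  · obtain ⟨k, -, hk⟩ := List.mem_map.1 ((Walk.support_map hp.toHom w) ▸ hx)
    exact ⟨k, hk⟩
  · exact Walk.eq_of_length_eq_zero ((Walk.length_map hp.toHom w).symm.trans h)
  · exact Walk.adj_of_length_eq_one ((Walk.length_map hp.toHom w).symm.trans h)

theorem IsSkel.adj_iff (hp : IsSkel G H p) (hG : G.IsAcyclic) (hH : H.Preconnected) {i j : ι} :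
    G.Adj (p i) (p j) ↔ H.Adj i j := by
  refine ⟨fun h => ?_, hp.adj i j⟩
  obtain ⟨w, hw, -, -, hw1⟩ := hp.exists_isPath hH i j
  have h2 : (Walk.cons h Walk.nil).IsPath := by simp [h.ne]
  have h3 := (hG.subsingleton_path _ _).elim ⟨w, hw⟩ ⟨Walk.cons h Walk.nil, h2⟩
  have h4 := congrArg (fun P : G.Path (p i) (p j) => P.1.length) h3
  exact hw1 h4

theorem IsSkel.eq_of_adj_off (hp : IsSkel G H p) (hG : G.IsAcyclic) (hH : H.Preconnected)
    {i j : ι} {x : V} (hx : x ∉ Set.range p) (hi : G.Adj (p i) x) (hj : G.Adj (p j) x) :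
    i = j := by
  obtain ⟨w, hw, hs, hw0, -⟩ := hp.exists_isPath hH i j
  have h1' : (Walk.cons hi.symm w).IsPath := by
    rw [Walk.cons_isPath_iff]
    exact ⟨hw, fun hmem => hx (hs x hmem)⟩
  have h2 : (Walk.cons hj.symm Walk.nil).IsPath := by simp [hj.ne']
  have h3 := (hG.subsingleton_path _ _).elim ⟨_, h1'⟩ ⟨_, h2⟩
  have h4 := congrArg (fun P : G.Path x (p j) => P.1.length) h3
  simp only [Walk.length_cons, Walk.length_nil] at h4
  exact hw0 (by omega)

/-- The graph `H` with a pendant vertex attached at `t`. -/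
def pendant (H : SimpleGraph ι) (t : ι) : SimpleGraph (Option ι) where
  Adj o o' := match o, o' with
    | some i, some j => H.Adj i j
    | some i, none => i = t
    | none, some j => j = t
    | none, none => False
  symm := ⟨by
    rintro (_ | i) (_ | j) h
    · exact h
    · exact h
    · exact h
    · exact H.adj_symm h⟩
  loopless := ⟨by
    rintro (_ | i) h
    · exact h
    · exact H.irrefl h⟩

theorem pendant_adj_some {t i j : ι} : (pendant H t).Adj (some i) (some j) ↔ H.Adj i j := Iff.rfl

theorem pendant_adj_some_none {t i : ι} : (pendant H t).Adj (some i) none ↔ i = t := Iff.rfl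

theorem pendant_adj_none_some {t i : ι} : (pendant H t).Adj none (some i) ↔ i = t := Iff.rfl

/-- Extension of `p` by the vertex `u`. -/
def extendBy (p : ι → V) (u : V) : Option ι → V := fun o => o.elim u p

theorem pendant_preconnected (hH : H.Preconnected) (t : ι) : (pendant H t).Preconnected := by
  let f : H →g pendant H t := ⟨some, fun {i j} h => h⟩
  have hs : ∀ i j, (pendant H t).Reachable (some i) (some j) := fun i j => (hH i j).map f
  have hn : ∀ i, (pendant H t).Reachable none (some i) := fun i => by
    have h : (pendant H t).Adj none (some t) := rfl
    exact h.reachable.trans (hs t i)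
  rintro (_ | i) (_ | j)
  · exact Reachable.refl _
  · exact hn j
  · exact (hn i).symm
  · exact hs i j

theorem range_extendBy (p : ι → V) (u : V) :
    Set.range (extendBy p u) = insert u (Set.range p) := by
  ext x
  constructor
  · rintro ⟨_ | i, rfl⟩
    · exact Or.inl rfl
    · exact Or.inr ⟨i, rfl⟩
  · rintro (rfl | ⟨i, rfl⟩)
    · exact ⟨none, rfl⟩
    · exact ⟨some i, rfl⟩

theorem IsSkel.extend (hp : IsSkel G H p) {t : ι} {u : V} (hu : G.Adj (p t) u)
    (hu' : u ∉ Set.range p) : IsSkel G (pendant H t) (extendBy p u) where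
  inj := by
    rintro (_ | i) (_ | j) h
    · rfl
    · exact absurd ⟨j, h.symm⟩ hu'
    · exact absurd ⟨i, h⟩ hu'
    · exact congrArg some (hp.inj h)
  adj := by
    rintro (_ | i) (_ | j) h
    · exact h.elim
    · have h' : j = t := h
      subst h'; exact hu.symm
    · have h' : i = t := h
      subst h'; exact hu
    · exact hp.adj i j h

theorem IsSkel.not_adj_off (hp : IsSkel G H p) (hG : G.IsAcyclic) (hH : H.Preconnected)
    {i j : ι} {x y : V} (hx : x ∉ Set.range p) (hy : y ∉ Set.range p) (hi : G.Adj (p i) x)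
    (hj : G.Adj (p j) y) : ¬ G.Adj x y := by
  intro hxy
  have h := (hp.extend hi hx).eq_of_adj_off hG (pendant_preconnected hH i) (i := some j)
    (j := none) (x := y) ?_ hj hxy
  · cases h
  · rw [range_extendBy]
    rintro (h | h)
    · exact hxy.ne h.symm
    · exact hy h

variable [Fintype V]

theorem IsSkel.offNbrs_disjoint (hp : IsSkel G H p) (hG : G.IsAcyclic) (hH : H.Preconnected)
    {i j : ι} (hij : i ≠ j) : Disjoint (offNbrs G p i) (offNbrs G p j) := by
  rw [Finset.disjoint_left]
  intro x hx hy
  rw [mem_offNbrs] at hx hy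
  exact hij (hp.eq_of_adj_off hG hH hx.2 hx.1 hy.1)

theorem IsSkel.degIn_off (hp : IsSkel G H p) (hG : G.IsAcyclic) (hH : H.Preconnected)
    {a : ι → ℕ} {X : Finset V} (hX : X ∈ leafFamily G p a) {i : ι} {x : V}
    (hx : x ∈ offNbrs G p i) : degIn G X x = 1 := by
  classical
  rw [mem_leafFamily] at hX
  rw [mem_offNbrs] at hx
  rw [degIn, Finset.card_eq_one]
  refine ⟨p i, ?_⟩
  ext y
  simp only [Finset.mem_filter, Finset.mem_singleton]
  constructor
  · rintro ⟨hy, hadj⟩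
    rcases hX.2.1 y hy with ⟨j, rfl⟩ | ⟨j, hj⟩
    · rw [hp.eq_of_adj_off hG hH hx.2 hx.1 hadj.symm]
    · rw [mem_offNbrs] at hj
      exact absurd hadj (hp.not_adj_off hG hH hx.2 hj.2 hx.1 hj.1)
  · rintro rfl
    exact ⟨hX.1 i, hx.1.symm⟩

theorem IsSkel.connected_of_mem (hp : IsSkel G H p) (hH : H.Connected)
    {a : ι → ℕ} {X : Finset V} (hX : X ∈ leafFamily G p a) :
    (G.induce (X : Set V)).Connected := by
  classical
  rw [mem_leafFamily] at hX
  obtain ⟨i₀⟩ := hH.nonempty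
  let f : H →g G.induce (X : Set V) := ⟨fun i => ⟨p i, hX.1 i⟩, fun {i j} h => hp.adj i j h⟩
  have key : ∀ x : (X : Set V), (G.induce (X : Set V)).Reachable (f i₀) x := by
    rintro ⟨x, hx⟩
    rcases hX.2.1 x hx with ⟨j, rfl⟩ | ⟨j, hj⟩
    · exact (hH.preconnected i₀ j).map f
    · refine ((hH.preconnected i₀ j).map f).trans ?_
      have : (G.induce (X : Set V)).Adj (f j) ⟨x, hx⟩ := (mem_offNbrs.1 hj).1
      exact this.reachable
  have : Nonempty (X : Set V) := ⟨f i₀⟩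
  exact ⟨fun x y => (key x).symm.trans (key y)⟩

variable [Fintype ι]

theorem IsSkel.card_leafFamily (hp : IsSkel G H p) (hG : G.IsAcyclic) (hH : H.Preconnected)
    (a : ι → ℕ) : (leafFamily G p a).card = chooseProd (offDeg G p) a := by
  classical
  have h1 : chooseProd (offDeg G p) a
      = (Fintype.piFinset fun i => Finset.powersetCard (a i) (offNbrs G p i)).card := by
    rw [Fintype.card_piFinset]
    exact Finset.prod_congr rfl fun i _ => by rw [Finset.card_powersetCard]; rfl
  rw [h1]
  have hcap : ∀ Y ∈ Fintype.piFinset fun i => Finset.powersetCard (a i) (offNbrs G p i),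
      ∀ i, (Finset.univ.image p ∪ Finset.univ.biUnion Y) ∩ offNbrs G p i = Y i := by
    intro Y hY i
    simp only [Fintype.mem_piFinset, Finset.mem_powersetCard] at hY
    ext x
    simp only [Finset.mem_inter, Finset.mem_union, Finset.mem_image, Finset.mem_univ, true_and,
      Finset.mem_biUnion]
    constructor
    · rintro ⟨⟨j, rfl⟩ | ⟨j, hj⟩, hx⟩
      · exact absurd ⟨j, rfl⟩ (mem_offNbrs.1 hx).2
      · by_cases hij : j = i
        · subst hij; exact hj
        · exact absurd hx (Finset.disjoint_left.1 (hp.offNbrs_disjoint hG hH hij)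
            ((hY j).1 hj))
    · intro hx
      exact ⟨Or.inr ⟨i, hx⟩, (hY i).1 hx⟩
  refine Finset.card_bij' (fun X _ i => X ∩ offNbrs G p i)
    (fun Y _ => Finset.univ.image p ∪ Finset.univ.biUnion Y) ?_ ?_ ?_ ?_
  · intro X hX
    rw [mem_leafFamily] at hX
    simp only [Fintype.mem_piFinset, Finset.mem_powersetCard]
    exact fun i => ⟨Finset.inter_subset_right, hX.2.2 i⟩
  · intro Y hY
    have hY' := hY
    simp only [Fintype.mem_piFinset, Finset.mem_powersetCard] at hY'
    rw [mem_leafFamily]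
    refine ⟨fun i => by simp, fun x hx => ?_, fun i => ?_⟩
    · simp only [Finset.mem_union, Finset.mem_image, Finset.mem_univ, true_and,
        Finset.mem_biUnion] at hx
      rcases hx with ⟨j, rfl⟩ | ⟨j, hj⟩
      · exact Or.inl ⟨j, rfl⟩
      · exact Or.inr ⟨j, (hY' j).1 hj⟩
    · rw [hcap Y hY]; exact (hY' i).2
  · intro X hX
    rw [mem_leafFamily] at hX
    ext x
    simp only [Finset.mem_union, Finset.mem_image, Finset.mem_univ, true_and,
        Finset.mem_biUnion, Finset.mem_inter]
    constructor
    · rintro (⟨j, rfl⟩ | ⟨j, hj, -⟩)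
      · exact hX.1 j
      · exact hj
    · intro hx
      rcases hX.2.1 x hx with ⟨j, rfl⟩ | ⟨j, hj⟩
      · exact Or.inl ⟨j, rfl⟩
      · exact Or.inr ⟨j, hx, hj⟩
  · intro Y hY
    exact funext fun i => hcap Y hY i

theorem IsSkel.degIn_skel (hp : IsSkel G H p) (hG : G.IsAcyclic) (hH : H.Preconnected)
    {a : ι → ℕ} {X : Finset V} (hX : X ∈ leafFamily G p a) (i : ι) :
    degIn G X (p i) = degIn H Finset.univ i + a i := by
  classical
  rw [mem_leafFamily] at hX
  have h1 : X.filter (G.Adj (p i)) = (Finset.univ.filter (H.Adj i)).image p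
      ∪ (X ∩ offNbrs G p i) := by
    ext x
    simp only [Finset.mem_filter, Finset.mem_union, Finset.mem_image, Finset.mem_univ, true_and,
      Finset.mem_inter, mem_offNbrs]
    constructor
    · rintro ⟨hx, hadj⟩
      by_cases hr : x ∈ Set.range p
      · obtain ⟨j, rfl⟩ := hr
        exact Or.inl ⟨j, (hp.adj_iff hG hH).1 hadj, rfl⟩
      · exact Or.inr ⟨hx, hadj, hr⟩
    · rintro (⟨j, hj, rfl⟩ | ⟨hx, hadj, -⟩)
      · exact ⟨hX.1 j, hp.adj i j hj⟩
      · exact ⟨hx, hadj⟩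
  rw [degIn, h1, Finset.card_union_of_disjoint, hX.2.2 i, Finset.card_image_of_injective _ hp.inj]
  · rfl
  · rw [Finset.disjoint_left]
    rintro x hx hx'
    simp only [Finset.mem_image, Finset.mem_filter, Finset.mem_univ, true_and] at hx
    obtain ⟨j, -, rfl⟩ := hx
    exact (mem_offNbrs.1 (Finset.mem_inter.1 hx').2).2 ⟨j, rfl⟩

theorem IsSkel.sum_degIn (hp : IsSkel G H p) (hG : G.IsAcyclic) (hH : H.Preconnected)
    {a : ι → ℕ} {X : Finset V} (hX : X ∈ leafFamily G p a) (f : ℕ → ℕ) :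
    ∑ x ∈ X, f (degIn G X x)
      = ∑ i, f (a i + degIn H Finset.univ i) + (∑ i, a i) * f 1 := by
  classical
  have hX' := hX
  rw [mem_leafFamily] at hX'
  have h1 : X = Finset.univ.image p ∪ Finset.univ.biUnion fun i => X ∩ offNbrs G p i := by
    ext x
    simp only [Finset.mem_union, Finset.mem_image, Finset.mem_univ, true_and,
        Finset.mem_biUnion, Finset.mem_inter]
    constructor
    · intro hx
      rcases hX'.2.1 x hx with ⟨j, rfl⟩ | ⟨j, hj⟩
      · exact Or.inl ⟨j, rfl⟩
      · exact Or.inr ⟨j, hx, hj⟩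
    · rintro (⟨j, rfl⟩ | ⟨j, hj, -⟩)
      · exact hX'.1 j
      · exact hj
  have hd : Disjoint (Finset.univ.image p)
      (Finset.univ.biUnion fun i => X ∩ offNbrs G p i) := by
    rw [Finset.disjoint_left]
    intro x hx hx'
    simp only [Finset.mem_image, Finset.mem_univ, true_and, Finset.mem_biUnion,
      Finset.mem_inter] at hx hx'
    obtain ⟨j, rfl⟩ := hx
    obtain ⟨i, -, hi⟩ := hx'
    exact (mem_offNbrs.1 hi).2 ⟨j, rfl⟩
  have h2 : ∑ x ∈ X, f (degIn G X x)
      = ∑ x ∈ Finset.univ.image p ∪ Finset.univ.biUnion fun i => X ∩ offNbrs G p i,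
        f (degIn G X x) := by rw [← h1]
  rw [h2, Finset.sum_union hd, Finset.sum_image fun i _ j _ h => hp.inj h, Finset.sum_biUnion]
  · congr 1
    · exact Finset.sum_congr rfl fun i _ => by rw [hp.degIn_skel hG hH hX, add_comm]
    · rw [Finset.sum_mul]
      refine Finset.sum_congr rfl fun i _ => ?_
      rw [Finset.sum_congr rfl fun x hx =>
        congrArg f (hp.degIn_off hG hH hX (Finset.mem_inter.1 hx).2), Finset.sum_const,
        hX'.2.2 i, smul_eq_mul]
  · intro i _ j _ hij
    exact (hp.offNbrs_disjoint hG hH hij).mono Finset.inter_subset_right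
      Finset.inter_subset_right

theorem IsSkel.card_of_mem (hp : IsSkel G H p) (hG : G.IsAcyclic) (hH : H.Preconnected)
    {a : ι → ℕ} {X : Finset V} (hX : X ∈ leafFamily G p a) :
    X.card = Fintype.card ι + ∑ i, a i := by
  have := hp.sum_degIn hG hH hX fun _ => 1
  simpa using this

theorem IsSkel.range_eq (hp : IsSkel G H p) (hG : G.IsAcyclic) (hH : H.Preconnected)
    {a : ι → ℕ} {X : Finset V} (hX : X ∈ leafFamily G p a)
    (ha : ∀ i, 2 ≤ a i + degIn H Finset.univ i) :
    Set.range p = {x | x ∈ X ∧ 2 ≤ degIn G X x} := by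
  classical
  have hX' := hX
  rw [mem_leafFamily] at hX'
  ext x
  constructor
  · rintro ⟨i, rfl⟩
    exact ⟨hX'.1 i, by rw [hp.degIn_skel hG hH hX, add_comm]; exact ha i⟩
  · rintro ⟨hx, hd⟩
    rcases hX'.2.1 x hx with h | ⟨j, hj⟩
    · exact h
    · rw [hp.degIn_off hG hH hX hj] at hd; omega

end Skeleton

section Pendant

variable {V ι : Type*} {G : SimpleGraph V} {H : SimpleGraph ι} {p : ι → V}

theorem degIn_pendant_some [Fintype ι] [DecidableEq ι] (H : SimpleGraph ι) (t i : ι) :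
    degIn (pendant H t) Finset.univ (some i)
      = degIn H Finset.univ i + (Pi.single t 1 : ι → ℕ) i := by
  classical
  have h1 : Finset.univ.filter ((pendant H t).Adj (some i))
      = (Finset.univ.filter (H.Adj i)).map Function.Embedding.some
        ∪ (if i = t then {none} else ∅) := by
    ext o
    rcases o with _ | j
    · by_cases hi : i = t <;> simp [pendant_adj_some_none, hi]
    · by_cases hi : i = t <;> simp [pendant_adj_some, hi]
  rw [degIn, h1, Finset.card_union_of_disjoint, Finset.card_map]
  · congr 1
    by_cases hi : i = t
    · subst hi; simp
    · simp [hi]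
  · by_cases hi : i = t <;> simp [hi]

theorem degIn_pendant_none [Fintype ι] (H : SimpleGraph ι) (t : ι) :
    degIn (pendant H t) Finset.univ none = 1 := by
  classical
  rw [degIn, Finset.card_eq_one]
  refine ⟨some t, ?_⟩
  ext o
  rcases o with _ | j <;> simp [pendant_adj_none_some]

variable [Fintype V]

theorem IsSkel.offDeg_extendBy_some [DecidableEq ι] (hp : IsSkel G H p) (hG : G.IsAcyclic)
    (hH : H.Preconnected) {t : ι} {u : V} (hu : u ∈ offNbrs G p t) (i : ι) :
    offDeg G (extendBy p u) (some i) = (offDeg G p - Pi.single t 1 : ι → ℕ) i := by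
  classical
  have h1 : offNbrs G (extendBy p u) (some i) = (offNbrs G p i).erase u := by
    ext x
    rw [Finset.mem_erase, mem_offNbrs, mem_offNbrs, range_extendBy, Set.mem_insert_iff, not_or]
    exact ⟨fun h => ⟨h.2.1, h.1, h.2.2⟩, fun h => ⟨h.2.1, h.1, h.2.2⟩⟩
  rw [offDeg, h1]
  by_cases hi : i = t
  · subst hi
    rw [Finset.card_erase_of_mem hu]
    simp [offDeg]
  · rw [Finset.erase_eq_of_notMem]
    · simp [hi, offDeg]
    · exact Finset.disjoint_right.1 (hp.offNbrs_disjoint hG hH hi) hu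

theorem chooseProd_extendBy [Fintype ι] [DecidableEq ι] (hp : IsSkel G H p) (hG : G.IsAcyclic)
    (hH : H.Preconnected) {t : ι} {u : V} (hu : u ∈ offNbrs G p t) (b : ι → ℕ) (m : ℕ) :
    chooseProd (offDeg G (extendBy p u)) (extendBy b m)
      = (offDeg G (extendBy p u) none).choose m * chooseProd (offDeg G p - Pi.single t 1) b := by
  rw [chooseProd, Fintype.prod_option]
  congr 1
  exact Finset.prod_congr rfl fun i _ => by rw [hp.offDeg_extendBy_some hG hH hu]; rfl

/-- A large tree has a vertex at distance two from the skeleton. -/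
theorem exists_child [Fintype ι] (hG : G.Connected) [Nonempty ι]
    (hcard : Fintype.card ι + ∑ i, offDeg G p i < Fintype.card V) :
    ∃ t, ∃ u ∈ offNbrs G p t, 1 ≤ offDeg G (extendBy p u) none := by
  classical
  set Q : Finset V := Finset.univ.image p ∪ Finset.univ.biUnion (offNbrs G p) with hQ
  have hQc : Q.card < Fintype.card V := by
    refine lt_of_le_of_lt (Finset.card_union_le _ _) (lt_of_le_of_lt ?_ hcard)
    exact Nat.add_le_add (Finset.card_image_le.trans_eq (Finset.card_univ))
      Finset.card_biUnion_le
  obtain ⟨z, hz⟩ : ∃ z, z ∉ Q := by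
    by_contra! h
    rw [(Finset.eq_univ_iff_forall (s := Q)).2 h, Finset.card_univ] at hQc
    exact lt_irrefl _ hQc
  obtain ⟨i₀⟩ := (inferInstance : Nonempty ι)
  have hi₀ : p i₀ ∈ Q := by simp [hQ]
  obtain ⟨w⟩ := hG.preconnected (p i₀) z
  obtain ⟨d, -, hd1, hd2⟩ := w.exists_boundary_dart (Q : Set V) hi₀ hz
  have hadj := d.adj
  set u := d.fst
  set y := d.snd
  have hy : y ∉ Set.range p := by
    rintro ⟨j, hj⟩
    exact hd2 (by rw [← hj]; simp [hQ])
  have hu : u ∉ Set.range p := by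
    rintro ⟨j, hj⟩
    refine hd2 ?_
    simp only [hQ, Finset.coe_union, Finset.coe_biUnion, Set.mem_union, Set.mem_iUnion]
    refine Or.inr ⟨j, by simp, ?_⟩
    rw [Finset.mem_coe, mem_offNbrs, hj]
    exact ⟨hadj, hy⟩
  have hu' : ∃ t, u ∈ offNbrs G p t := by
    have : u ∈ Q := hd1
    simp only [hQ, Finset.mem_union, Finset.mem_image, Finset.mem_univ, true_and,
      Finset.mem_biUnion] at this
    rcases this with ⟨j, hj⟩ | h
    · exact absurd ⟨j, hj⟩ hu
    · exact h
  obtain ⟨t, ht⟩ := hu'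
  refine ⟨t, u, ht, Finset.card_pos.2 ⟨y, ?_⟩⟩
  rw [mem_offNbrs, range_extendBy]
  refine ⟨hadj, ?_⟩
  rintro (h | h)
  · exact hadj.ne h.symm
  · exact hy h

end Pendant

section PathSkeleton

variable {V : Type*} {G : SimpleGraph V}

theorem exists_walk_of_chain (p : ℕ → V) (n : ℕ) (h : ∀ i < n, G.Adj (p i) (p (i + 1))) :
    ∃ w : G.Walk (p 0) (p n), w.support = (List.range (n + 1)).map p := by
  induction n with
  | zero => exact ⟨Walk.nil, by simp⟩
  | succ n ih =>
    obtain ⟨w, hw⟩ := ih fun i hi => h i (by omega)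
    refine ⟨w.concat (h n (by omega)), ?_⟩
    rw [Walk.support_concat, hw, List.range_succ (n := n + 1), List.map_append]
    simp

theorem chain_unique (hG : G.IsAcyclic) {p p' : ℕ → V} {n : ℕ}
    (h : ∀ i < n, G.Adj (p i) (p (i + 1))) (h' : ∀ i < n, G.Adj (p' i) (p' (i + 1)))
    (hi : Set.InjOn p (Set.Iic n)) (hi' : Set.InjOn p' (Set.Iic n))
    (h0 : p 0 = p' 0) (hn : p n = p' n) : ∀ i ≤ n, p i = p' i := by
  have nodup : ∀ q : ℕ → V, Set.InjOn q (Set.Iic n) → ((List.range (n + 1)).map q).Nodup := by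
    intro q hq
    refine List.Nodup.map_on ?_ List.nodup_range
    intro x hx y hy hxy
    rw [List.mem_range] at hx hy
    exact hq (Set.mem_Iic.2 (by omega)) (Set.mem_Iic.2 (by omega)) hxy
  have key : ∀ u v, p 0 = u → p n = v → p' 0 = u → p' n = v →
      (List.range (n + 1)).map p = (List.range (n + 1)).map p' := by
    intro u v e1 e2 e3 e4
    obtain ⟨w, hw⟩ := exists_walk_of_chain p n h
    obtain ⟨w', hw'⟩ := exists_walk_of_chain p' n h'
    have := (hG.subsingleton_path u v).elim
      ⟨w.copy e1 e2, (Walk.isPath_copy w e1 e2).2 (Walk.IsPath.mk' (hw ▸ nodup p hi))⟩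
      ⟨w'.copy e3 e4, (Walk.isPath_copy w' e3 e4).2 (Walk.IsPath.mk' (hw' ▸ nodup p' hi'))⟩
    have h2 := congrArg (fun P : G.Path u v => P.1.support) this
    simp only [Walk.support_copy] at h2
    rw [← hw, ← hw', h2]
  intro i hin
  have h3 := key _ _ rfl rfl h0.symm hn.symm
  exact List.map_inj_left.1 h3 i (by simpa using by omega)

theorem IsSkel.path_unique {m : ℕ} {p p' : Fin (m + 1) → V} (hG : G.IsAcyclic)
    (hp : IsSkel G (pathGraph (m + 1)) p) (hp' : IsSkel G (pathGraph (m + 1)) p')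
    (h0 : p 0 = p' 0) (hl : p (Fin.last m) = p' (Fin.last m)) : p = p' := by
  have hchain : ∀ q : Fin (m + 1) → V, IsSkel G (pathGraph (m + 1)) q →
      ∀ i < m, G.Adj (q (Fin.ofNat (m + 1) i)) (q (Fin.ofNat (m + 1) (i + 1))) := by
    intro q hq i hi
    refine hq.adj _ _ (pathGraph_adj.2 (Or.inl ?_))
    simp only [Fin.val_ofNat]
    rw [Nat.mod_eq_of_lt (by omega), Nat.mod_eq_of_lt (by omega)]
  have hinj : ∀ q : Fin (m + 1) → V, IsSkel G (pathGraph (m + 1)) q →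
      Set.InjOn (fun i => q (Fin.ofNat (m + 1) i)) (Set.Iic m) := by
    intro q hq i hi j hj hij
    have h2 := congrArg Fin.val (hq.inj hij)
    rw [Set.mem_Iic] at hi hj
    simp only [Fin.val_ofNat] at h2
    rwa [Nat.mod_eq_of_lt (by omega), Nat.mod_eq_of_lt (by omega)] at h2
  have hlast : Fin.ofNat (m + 1) m = Fin.last m := by
    ext; simp
  have key := chain_unique hG (hchain p hp) (hchain p' hp') (hinj p hp) (hinj p' hp')
    (by simpa using h0) (by simpa only [hlast] using hl)
  funext i
  have := key i.1 (by omega)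
  simpa using this

theorem IsSkel.not_interior {m : ℕ} {p₀ : Fin (m + 1) → V} {R : Set V} {x y : V} {j : Fin (m + 1)}
    (hp₀ : IsSkel G (pathGraph (m + 1)) p₀) (hR : Set.range p₀ ⊆ R) (hj : p₀ j = x)
    (hx : ∀ z ∈ R, G.Adj x z → z = y) : x = p₀ 0 ∨ x = p₀ (Fin.last m) := by
  by_cases h0 : j.1 = 0
  · left; rw [← hj]; congr 1; ext; simpa using h0
  by_cases hl : j.1 = m
  · right; rw [← hj]; congr 1; ext; simpa using hl
  have h1 := hx (p₀ ⟨j.1 - 1, by omega⟩) (hR ⟨_, rfl⟩)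
    (hj ▸ hp₀.adj j ⟨j.1 - 1, by omega⟩
      (pathGraph_adj.2 (Or.inr (Nat.sub_add_cancel (Nat.pos_of_ne_zero h0)))))
  have h2 := hx (p₀ ⟨j.1 + 1, by omega⟩) (hR ⟨_, rfl⟩)
    (hj ▸ hp₀.adj j ⟨j.1 + 1, by omega⟩ (pathGraph_adj.2 (Or.inl rfl)))
  have h3 := congrArg Fin.val (hp₀.inj (h1.trans h2.symm))
  simp only at h3
  omega

theorem IsSkel.adj_zero {m : ℕ} {p : Fin (m + 1) → V} (hG : G.IsAcyclic)
    (hp : IsSkel G (pathGraph (m + 1)) p) {z : V} (hz : z ∈ Set.range p) (h : G.Adj (p 0) z) :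
    z = p (Fin.ofNat (m + 1) 1) := by
  obtain ⟨j, rfl⟩ := hz
  have h1 := (hp.adj_iff hG (pathGraph_connected m).preconnected).1 h
  rw [pathGraph_adj] at h1
  congr 1
  ext
  simp only [Fin.val_ofNat, Fin.val_zero] at *
  rw [Nat.mod_eq_of_lt (by omega)]
  omega

theorem IsSkel.adj_last {m : ℕ} {p : Fin (m + 1) → V} (hG : G.IsAcyclic)
    (hp : IsSkel G (pathGraph (m + 1)) p) {z : V} (hz : z ∈ Set.range p)
    (h : G.Adj (p (Fin.last m)) z) : z = p (Fin.ofNat (m + 1) (m - 1)) := by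
  obtain ⟨j, rfl⟩ := hz
  have h1 := (hp.adj_iff hG (pathGraph_connected m).preconnected).1 h
  rw [pathGraph_adj] at h1
  congr 1
  ext
  simp only [Fin.val_ofNat, Fin.val_last] at *
  rw [Nat.mod_eq_of_lt (by omega)]
  omega

variable [Fintype V]

open scoped Classical in
/-- The path skeletons with range `R`. -/
noncomputable def pathSkels (G : SimpleGraph V) (s : ℕ) (R : Set V) : Finset (Fin s → V) :=
  Finset.univ.filter fun p => IsSkel G (pathGraph s) p ∧ Set.range p = R

theorem card_pathSkels_le (hG : G.IsAcyclic) (m : ℕ) (R : Set V) :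
    (pathSkels G (m + 1) R).card ≤ 2 := by
  classical
  rcases (pathSkels G (m + 1) R).eq_empty_or_nonempty with h | ⟨p₀, hp₀⟩
  · simp [h]
  simp only [pathSkels, Finset.mem_filter, Finset.mem_univ, true_and] at hp₀
  obtain ⟨hp₀, hR⟩ := hp₀
  have h0 : ∀ p ∈ pathSkels G (m + 1) R, p 0 = p₀ 0 ∨ p 0 = p₀ (Fin.last m) := by
    intro p hp
    simp only [pathSkels, Finset.mem_filter, Finset.mem_univ, true_and] at hp
    have h1 : p 0 ∈ Set.range p₀ := by rw [hR, ← hp.2]; exact ⟨0, rfl⟩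
    obtain ⟨j, hj⟩ := h1
    exact hp₀.not_interior hR.subset hj fun z hz hadj => hp.1.adj_zero hG (hp.2 ▸ hz) hadj
  have hl : ∀ p ∈ pathSkels G (m + 1) R, p (Fin.last m) = p₀ 0 ∨
      p (Fin.last m) = p₀ (Fin.last m) := by
    intro p hp
    simp only [pathSkels, Finset.mem_filter, Finset.mem_univ, true_and] at hp
    have h1 : p (Fin.last m) ∈ Set.range p₀ := by rw [hR, ← hp.2]; exact ⟨_, rfl⟩
    obtain ⟨j, hj⟩ := h1
    exact hp₀.not_interior hR.subset hj fun z hz hadj => hp.1.adj_last hG (hp.2 ▸ hz) hadj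
  have hinj : Set.InjOn (fun p : Fin (m + 1) → V => p 0) (pathSkels G (m + 1) R) := by
    intro p hp p' hp' h
    have a1 := h0 p hp
    have a2 := hl p hp
    have a3 := hl p' hp'
    simp only at h
    simp only [pathSkels, Finset.coe_filter, Finset.mem_univ, true_and, Set.mem_ofPred_eq] at hp hp'
    refine IsSkel.path_unique hG hp.1 hp'.1 h ?_
    rcases Nat.eq_zero_or_pos m with rfl | hm
    · exact h
    · have n1 : p 0 ≠ p (Fin.last m) := fun e => by
        have := congrArg Fin.val (hp.1.inj e); simp at this; omega
      have n2 : p' 0 ≠ p' (Fin.last m) := fun e => by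
        have := congrArg Fin.val (hp'.1.inj e); simp at this; omega
      grind
  calc (pathSkels G (m + 1) R).card
      = ((pathSkels G (m + 1) R).image fun p => p 0).card := (Finset.card_image_of_injOn hinj).symm
    _ ≤ ({p₀ 0, p₀ (Fin.last m)} : Finset V).card := by
        refine Finset.card_le_card fun x hx => ?_
        obtain ⟨p, hp, rfl⟩ := Finset.mem_image.1 hx
        simpa using h0 p hp
    _ ≤ 2 := Finset.card_le_two

open scoped Classical in
/-- The path skeletons whose range becomes `R` after adding one neighbour. -/
noncomputable def extSkels (G : SimpleGraph V) (s : ℕ) (R : Set V) : Finset (Fin s → V) :=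
  Finset.univ.filter fun p => IsSkel G (pathGraph s) p ∧
    ∃ t, ∃ u ∈ offNbrs G p t, Set.range (extendBy p u) = R

theorem card_extSkels_le (hG : G.IsAcyclic) (m : ℕ) (R : Set V) :
    (extSkels G (m + 1) R).card ≤ 6 := by
  classical
  rcases (extSkels G (m + 1) R).eq_empty_or_nonempty with h | ⟨p₀, hp₀⟩
  · simp [h]
  simp only [extSkels, Finset.mem_filter, Finset.mem_univ, true_and] at hp₀
  obtain ⟨hp₀, t₀, u₀, hu₀, hR⟩ := hp₀
  rw [range_extendBy] at hR
  have hsub : extSkels G (m + 1) R ⊆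
      ({u₀, p₀ 0, p₀ (Fin.last m)} : Finset V).biUnion fun u => pathSkels G (m + 1) (R \ {u}) := by
    intro p hp
    simp only [extSkels, Finset.mem_filter, Finset.mem_univ, true_and] at hp
    obtain ⟨hp, t, u, hu, hRu⟩ := hp
    rw [range_extendBy] at hRu
    rw [mem_offNbrs] at hu
    refine Finset.mem_biUnion.2 ⟨u, ?_, ?_⟩
    · have hmem : u ∈ R := by rw [← hRu]; exact Or.inl rfl
      rw [← hR] at hmem
      rcases hmem with h | ⟨j, hj⟩
      · simp [h]
      · have := hp₀.not_interior (R := R) (y := p t) (by rw [← hR]; exact Set.subset_insert _ _) hj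
          (fun z hz hadj => by
            rw [← hRu] at hz
            rcases hz with rfl | ⟨i, rfl⟩
            · exact absurd rfl hadj.ne
            · rw [hp.eq_of_adj_off hG (pathGraph_connected m).preconnected hu.2 hu.1 hadj.symm])
        rcases this with h | h <;> simp [h]
    · simp only [pathSkels, Finset.mem_filter, Finset.mem_univ, true_and]
      refine ⟨hp, ?_⟩
      rw [← hRu, Set.insert_sdiff_self_of_notMem hu.2]
  calc (extSkels G (m + 1) R).card ≤ _ := Finset.card_le_card hsub
    _ ≤ ∑ u ∈ ({u₀, p₀ 0, p₀ (Fin.last m)} : Finset V), (pathSkels G (m + 1) (R \ {u})).card :=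
        Finset.card_biUnion_le
    _ ≤ ({u₀, p₀ 0, p₀ (Fin.last m)} : Finset V).card * 2 :=
        Finset.sum_le_card_nsmul _ _ _ fun u _ => card_pathSkels_le hG m _
    _ ≤ 3 * 2 := Nat.mul_le_mul_right _ Finset.card_le_three

end PathSkeleton

theorem sum_le_of_charge {β γ : Type*} [DecidableEq β] (P : Finset β) (B : Finset γ)
    (R : γ → Finset β) (F : β → ℕ) {K M : ℕ} (hR : ∀ X ∈ B, (R X).card ≤ M)
    (h : ∀ p ∈ P, ∃ Y ⊆ B, F p ≤ K * Y.card ∧ ∀ X ∈ Y, p ∈ R X) :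
    ∑ p ∈ P, F p ≤ K * M * B.card := by
  have h1 : ∀ p ∈ P, F p ≤ K * (B.filter fun X => p ∈ R X).card := by
    intro p hp
    obtain ⟨Y, hYB, hY, hYR⟩ := h p hp
    refine hY.trans (Nat.mul_le_mul_left _ (Finset.card_le_card fun X hX => ?_))
    exact Finset.mem_filter.2 ⟨hYB hX, hYR X hX⟩
  have h2 : ∑ p ∈ P, (B.filter fun X => p ∈ R X).card
      = ∑ X ∈ B, (P.filter fun p => p ∈ R X).card :=
    Finset.sum_card_bipartiteAbove_eq_sum_card_bipartiteBelow (fun p X => p ∈ R X)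
  calc ∑ p ∈ P, F p ≤ ∑ p ∈ P, K * (B.filter fun X => p ∈ R X).card := Finset.sum_le_sum h1
    _ = K * ∑ X ∈ B, (P.filter fun p => p ∈ R X).card := by rw [← Finset.mul_sum, h2]
    _ ≤ K * ∑ X ∈ B, M := by
        refine Nat.mul_le_mul_left _ (Finset.sum_le_sum fun X hX => le_trans ?_ (hR X hX))
        exact Finset.card_le_card fun p hp => (Finset.mem_filter.1 hp).2
    _ = K * M * B.card := by rw [Finset.sum_const, smul_eq_mul]; ring

theorem degIn_pathGraph (s : ℕ) (i : Fin s) : degIn (pathGraph s) Finset.univ i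
    = (if 0 < i.1 then 1 else 0) + (if i.1 + 1 < s then 1 else 0) := by
  classical
  have h1 : Finset.univ.filter ((pathGraph s).Adj i)
      = (Finset.univ.filter fun j : Fin s => j.1 + 1 = i.1)
        ∪ (Finset.univ.filter fun j : Fin s => i.1 + 1 = j.1) := by
    ext j
    simp only [Finset.mem_filter, Finset.mem_univ, true_and, Finset.mem_union, pathGraph_adj]
    exact or_comm
  rw [degIn, h1, Finset.card_union_of_disjoint]
  · congr 1
    · split_ifs with h
      · rw [Finset.card_eq_one]
        refine ⟨⟨i.1 - 1, by omega⟩, ?_⟩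
        ext j
        simp only [Finset.mem_filter, Finset.mem_univ, true_and, Finset.mem_singleton, Fin.ext_iff]
        omega
      · rw [Finset.card_eq_zero, Finset.filter_eq_empty_iff]
        intro j _; omega
    · split_ifs with h
      · rw [Finset.card_eq_one]
        refine ⟨⟨i.1 + 1, h⟩, ?_⟩
        ext j
        simp only [Finset.mem_filter, Finset.mem_univ, true_and, Finset.mem_singleton, Fin.ext_iff]
        omega
      · rw [Finset.card_eq_zero, Finset.filter_eq_empty_iff]
        intro j _; omega
  · rw [Finset.disjoint_filter]
    intro j _ h; omega

/-- The graph `S` has a spine of `s` vertices of degree at least two, the `i`-th of which has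
`a i` leaves. -/
def HasSpine {W : Type*} [Fintype W] (S : SimpleGraph W) (s : ℕ) (a : Fin s → ℕ) : Prop :=
  ∃ q : Fin s → W, IsSkel S (pathGraph s) q ∧ Finset.univ ∈ leafFamily S q a ∧
    ∀ i, 2 ≤ a i + degIn (pathGraph s) Finset.univ i

open scoped Classical in
/-- The copies of `S` in `G`. -/
noncomputable def copies {V W : Type*} [Fintype V] [Fintype W] (G : SimpleGraph V)
    (S : SimpleGraph W) : Finset (Finset V) :=
  Finset.univ.filter fun X => X.card = Fintype.card W ∧
    Nonempty (G.induce (X : Set V) ≃g S)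

open scoped Classical in
/-- The subtrees of `G` with as many vertices as `S` that are not copies of `S`. -/
noncomputable def others {V W : Type*} [Fintype V] [Fintype W] (G : SimpleGraph V)
    (S : SimpleGraph W) : Finset (Finset V) :=
  Finset.univ.filter fun X => (X.card = Fintype.card W ∧ (G.induce (X : Set V)).Connected) ∧
    ¬ Nonempty (G.induce (X : Set V) ≃g S)

/-- The vertices of degree at least two in `X`. -/
def innerSet {V : Type*} (G : SimpleGraph V) (X : Finset V) : Set V :=
  {x | x ∈ X ∧ 2 ≤ degIn G X x}

section Charge

variable {V W : Type*} [Fintype W] {G : SimpleGraph V} {S : SimpleGraph W}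

theorem degIn_eq_of_iso {X : Finset V} (φ : G.induce (X : Set V) ≃g S) (x : (X : Set V)) :
    degIn G X x = degIn S Finset.univ (φ x) := by
  classical
  refine Finset.card_bij' (fun y hy => φ ⟨y, (Finset.mem_filter.1 hy).1⟩)
    (fun w _ => (φ.symm w : V)) ?_ ?_ ?_ ?_
  · intro y hy
    rw [Finset.mem_filter] at hy ⊢
    refine ⟨Finset.mem_univ _, φ.map_rel_iff.2 ?_⟩
    exact hy.2
  · intro w hw
    rw [Finset.mem_filter] at hw ⊢
    refine ⟨(φ.symm w).2, ?_⟩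
    have h1 : (G.induce (X : Set V)).Adj x (φ.symm w) := by
      rw [← φ.map_rel_iff]
      simpa using hw.2
    exact h1
  · intro y hy
    simp
  · intro w hw
    simp

theorem sum_degIn_of_iso {X : Finset V} (φ : G.induce (X : Set V) ≃g S) (f : ℕ → ℕ) :
    ∑ x ∈ X, f (degIn G X x) = ∑ w, f (degIn S Finset.univ w) := by
  have h1 : ∑ x ∈ X, f (degIn G X x) = ∑ x : (X : Set V), f (degIn G X x) :=
    (Finset.sum_coe_sort X fun x => f (degIn G X x)).symm
  rw [h1]
  exact Fintype.sum_equiv φ.toEquiv _ _ fun x => by rw [degIn_eq_of_iso φ x]; rfl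

variable [Fintype V]

theorem HasSpine.card {s : ℕ} {a : Fin s → ℕ} (hS : S.IsTree) (h : HasSpine S s a) :
    Fintype.card W = s + ∑ i, a i := by
  obtain ⟨q, hq, hu, -⟩ := h
  have hpre : (pathGraph s).Preconnected := pathGraph_preconnected s
  have := hq.card_of_mem hS.isAcyclic hpre hu
  simpa using this

theorem HasSpine.sum_degIn {s : ℕ} {a : Fin s → ℕ} (hS : S.IsTree) (h : HasSpine S s a)
    (f : ℕ → ℕ) : ∑ w, f (degIn S Finset.univ w)
      = ∑ i, f (a i + degIn (pathGraph s) Finset.univ i) + (∑ i, a i) * f 1 := by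
  obtain ⟨q, hq, hu, -⟩ := h
  exact hq.sum_degIn hS.isAcyclic (pathGraph_preconnected s) hu f

theorem HasSpine.mem_others {ι : Type*} [Fintype ι] {s : ℕ} {a : Fin s → ℕ} (hS : S.IsTree)
    (h : HasSpine S s a) (hG : G.IsAcyclic) {H : SimpleGraph ι} (hH : H.Connected) {p : ι → V}
    (hp : IsSkel G H p) {b : ι → ℕ} {X : Finset V} (hX : X ∈ leafFamily G p b)
    (hcard : Fintype.card ι + ∑ i, b i = s + ∑ i, a i)
    (hiso : G.induce (X : Set V) ≃g S → False) : X ∈ others G S := by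
  simp only [others, Finset.mem_filter, Finset.mem_univ, true_and]
  refine ⟨⟨?_, hp.connected_of_mem hH hX⟩, fun ⟨φ⟩ => hiso φ⟩
  rw [hp.card_of_mem hG hH.preconnected hX, hcard, h.card hS]

/-- A family of subtrees whose degree statistics differ from those of `S`. -/
theorem HasSpine.family_subset_others {ι : Type*} [Fintype ι] {s : ℕ} {a : Fin s → ℕ}
    (hS : S.IsTree) (h : HasSpine S s a) (hG : G.IsAcyclic) {H : SimpleGraph ι}
    (hH : H.Connected) {p : ι → V} (hp : IsSkel G H p) {b : ι → ℕ}
    (hcard : Fintype.card ι + ∑ i, b i = s + ∑ i, a i) (f : ℕ → ℕ)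
    (hf : ∑ i, f (b i + degIn H Finset.univ i) + (∑ i, b i) * f 1
      ≠ ∑ i, f (a i + degIn (pathGraph s) Finset.univ i) + (∑ i, a i) * f 1) :
    leafFamily G p b ⊆ others G S := by
  intro X hX
  refine h.mem_others hS hG hH hp hX hcard fun φ => hf ?_
  rw [← hp.sum_degIn hG hH.preconnected hX f, sum_degIn_of_iso φ f, h.sum_degIn hS f]

/-- A family of subtrees with a different number of inner vertices. -/
theorem HasSpine.family_subset_others_of_ne {ι : Type*} [Fintype ι] {s : ℕ} {a : Fin s → ℕ}
    (hS : S.IsTree) (h : HasSpine S s a) (hG : G.IsAcyclic) {H : SimpleGraph ι}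
    (hH : H.Connected) {p : ι → V} (hp : IsSkel G H p) {b : ι → ℕ}
    (hcard : Fintype.card ι + ∑ i, b i = s + ∑ i, a i)
    (hb : ∀ i, 2 ≤ b i + degIn H Finset.univ i) (hne : Fintype.card ι ≠ s) :
    leafFamily G p b ⊆ others G S := by
  refine h.family_subset_others hS hG hH hp hcard (fun d => if 2 ≤ d then 1 else 0) ?_
  obtain ⟨q, -, -, ha⟩ := h
  simp only [hb, ha]
  simpa using hne

theorem HasSpine.exists_skel {s : ℕ} {a : Fin s → ℕ} (h : HasSpine S s a) {X : Finset V}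
    (φ : G.induce (X : Set V) ≃g S) :
    ∃ p, IsSkel G (pathGraph s) p ∧ X ∈ leafFamily G p a := by
  classical
  obtain ⟨q, hq, hu, -⟩ := h
  rw [mem_leafFamily] at hu
  have hr : ∀ x : (X : Set V), (x : V) ∈ Set.range (fun i => (φ.symm (q i) : V)) ↔
      φ x ∈ Set.range q := by
    intro x
    constructor
    · rintro ⟨i, hi⟩
      refine ⟨i, ?_⟩
      have : φ.symm (q i) = x := Subtype.ext hi
      rw [← this]; simp
    · rintro ⟨i, hi⟩
      refine ⟨i, ?_⟩
      simp [hi]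
  have hoff : ∀ (i : Fin s) (x : (X : Set V)),
      (x : V) ∈ offNbrs G (fun i => (φ.symm (q i) : V)) i ↔ φ x ∈ offNbrs S q i := by
    intro i x
    rw [mem_offNbrs, mem_offNbrs, hr]
    refine and_congr_left fun _ => ?_
    have h1 : (G.induce (X : Set V)).Adj (φ.symm (q i)) x ↔ S.Adj (q i) (φ x) := by
      rw [← φ.map_rel_iff]; simp
    exact h1
  refine ⟨fun i => φ.symm (q i), ⟨?_, ?_⟩, ?_⟩
  · intro i j hij
    exact hq.inj (φ.symm.injective (Subtype.ext hij))
  · intro i j hij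
    exact φ.symm.map_rel_iff.2 (hq.adj i j hij)
  · rw [mem_leafFamily]
    refine ⟨fun i => (φ.symm (q i)).2, fun x hx => ?_, fun i => ?_⟩
    · rcases hu.2.1 (φ ⟨x, hx⟩) (Finset.mem_univ _) with h1 | ⟨i, hi⟩
      · exact Or.inl ((hr ⟨x, hx⟩).2 h1)
      · exact Or.inr ⟨i, (hoff i ⟨x, hx⟩).2 hi⟩
    · rw [← hu.2.2 i]
      refine Finset.card_bij' (fun y hy => φ ⟨y, (Finset.mem_inter.1 hy).1⟩)
        (fun w _ => (φ.symm w : V)) ?_ ?_ ?_ ?_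
      · intro y hy
        rw [Finset.mem_inter] at hy
        simpa using (hoff i ⟨y, hy.1⟩).1 hy.2
      · intro w hw
        rw [Finset.mem_inter] at hw ⊢
        refine ⟨(φ.symm w).2, (hoff i (φ.symm w)).2 ?_⟩
        simpa using hw.2
      · intro y hy; simp
      · intro w hw; simp

open scoped Classical in
/-- All path skeletons with `s` vertices. -/
noncomputable def allSkels (G : SimpleGraph V) (s : ℕ) : Finset (Fin s → V) :=
  Finset.univ.filter fun p => IsSkel G (pathGraph s) p

theorem mem_allSkels {s : ℕ} {p : Fin s → V} :
    p ∈ allSkels G s ↔ IsSkel G (pathGraph s) p := by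
  simp [allSkels]

theorem HasSpine.card_copies_le {s : ℕ} {a : Fin s → ℕ} (h : HasSpine S s a) :
    (copies G S).card ≤ ∑ p ∈ allSkels G s, (leafFamily G p a).card := by
  classical
  refine le_trans (Finset.card_le_card fun X hX => ?_) Finset.card_biUnion_le
  simp only [copies, Finset.mem_filter, Finset.mem_univ, true_and] at hX
  obtain ⟨-, ⟨φ⟩⟩ := hX
  obtain ⟨p, hp, hX⟩ := h.exists_skel φ
  exact Finset.mem_biUnion.2 ⟨p, mem_allSkels.2 hp, hX⟩

open scoped Classical in
/-- The path skeletons that may be charged to `X`. -/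
noncomputable def chargers (G : SimpleGraph V) (s : ℕ) (X : Finset V) : Finset (Fin s → V) :=
  pathSkels G s (innerSet G X) ∪ extSkels G s (innerSet G X)

theorem mem_chargers {s : ℕ} {X : Finset V} {p : Fin s → V} : p ∈ chargers G s X ↔
    p ∈ pathSkels G s (innerSet G X) ∨ p ∈ extSkels G s (innerSet G X) := by
  simp [chargers]

theorem card_chargers_le (hG : G.IsAcyclic) (m : ℕ) (X : Finset V) :
    (chargers G (m + 1) X).card ≤ 8 := by
  classical
  exact (Finset.card_union_le _ _).trans
    (Nat.add_le_add (card_pathSkels_le hG m _) (card_extSkels_le hG m _))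

theorem HasSpine.charge_of_hasSwap {s K : ℕ} [NeZero s] {a : Fin s → ℕ} (hS : S.IsTree)
    (h : HasSpine S s a) (hG : G.IsAcyclic) {p : Fin s → V} (hp : IsSkel G (pathGraph s) p)
    (hsw : HasSwap K (degIn (pathGraph s) Finset.univ) (offDeg G p) a) :
    ∃ Y ⊆ others G S, (leafFamily G p a).card ≤ K * Y.card ∧ ∀ X ∈ Y, p ∈ chargers G s X := by
  obtain ⟨a', h1, h2, h3, h4⟩ := hsw
  obtain ⟨m, rfl⟩ : ∃ m, s = m + 1 := ⟨s - 1, by have := NeZero.ne s; omega⟩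
  have hH := pathGraph_connected m
  refine ⟨leafFamily G p a', ?_, ?_, ?_⟩
  · refine h.family_subset_others hS hG hH hp (by rw [h1]; simp) (fun d => d ^ 2) ?_
    rw [h1]
    simpa using h2
  · rwa [hp.card_leafFamily hG hH.preconnected, hp.card_leafFamily hG hH.preconnected]
  · intro X hX
    refine mem_chargers.2 (Or.inl ?_)
    simp only [pathSkels, Finset.mem_filter, Finset.mem_univ, true_and]
    exact ⟨hp, hp.range_eq hG hH.preconnected hX h3⟩

theorem HasSpine.stretch_family {s : ℕ} {a : Fin s → ℕ} (hS : S.IsTree) (hs : 2 ≤ s)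
    (h : HasSpine S s a) (hG : G.IsAcyclic) {p : Fin s → V} (hp : IsSkel G (pathGraph s) p)
    {t : Fin s} {u : V} (hu : u ∈ offNbrs G p t) {a' : Fin s → ℕ}
    (h1 : ∑ i, a' i + 2 = ∑ i, a i)
    (h3 : ∀ i, i ≠ t → 2 ≤ a' i + degIn (pathGraph s) Finset.univ i) :
    leafFamily G (extendBy p u) (extendBy a' 1) ⊆ others G S ∧
    (leafFamily G (extendBy p u) (extendBy a' 1)).card
      = offDeg G (extendBy p u) none * chooseProd (offDeg G p - Pi.single t 1) a' ∧
    ∀ X ∈ leafFamily G (extendBy p u) (extendBy a' 1),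
      p ∈ chargers G s X ∧ Set.range (extendBy p u) = innerSet G X := by
  obtain ⟨m, rfl⟩ : ∃ m, s = m + 1 := ⟨s - 1, by omega⟩
  have hH := pathGraph_connected m
  have hu1 := mem_offNbrs.1 hu
  have hpu := hp.extend hu1.1 hu1.2
  have hH' : (pendant (pathGraph (m + 1)) t).Connected :=
    ⟨pendant_preconnected hH.preconnected t⟩
  have hb : ∀ o, 2 ≤ extendBy a' 1 o + degIn (pendant (pathGraph (m + 1)) t) Finset.univ o := by
    rintro (_ | i)
    · rw [degIn_pendant_none]; rfl
    · rw [degIn_pendant_some, degIn_pathGraph]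
      change 2 ≤ a' i + _
      by_cases hi : i = t
      · subst hi
        rw [Pi.single_eq_same]
        split_ifs <;> omega
      · have := h3 i hi
        rw [degIn_pathGraph] at this
        rw [Pi.single_eq_of_ne hi]
        omega
  refine ⟨h.family_subset_others_of_ne hS hG hH' hpu ?_ hb (by simp), ?_, fun X hX => ?_⟩
  · rw [Fintype.sum_option, Fintype.card_option, Fintype.card_fin, ← h1]
    change _ + (1 + ∑ i, a' i) = _
    omega
  · rw [hpu.card_leafFamily hG hH'.preconnected,
      chooseProd_extendBy hp hG hH.preconnected hu, Nat.choose_one_right]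
  · have hr := hpu.range_eq hG hH'.preconnected hX hb
    refine ⟨mem_chargers.2 (Or.inr ?_), hr⟩
    simp only [extSkels, Finset.mem_filter, Finset.mem_univ, true_and]
    exact ⟨hp, t, u, hu, hr⟩

theorem HasSpine.charge_of_hasStretch {s K : ℕ} {a : Fin s → ℕ} (hS : S.IsTree) (hs : 2 ≤ s)
    (h : HasSpine S s a) (hG : G.IsAcyclic) {p : Fin s → V} (hp : IsSkel G (pathGraph s) p)
    {t : Fin s} {u : V} (hu : u ∈ offNbrs G p t) (hpos : 1 ≤ offDeg G (extendBy p u) none)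
    (hst : HasStretch K (degIn (pathGraph s) Finset.univ) (offDeg G p) a t) :
    ∃ Y ⊆ others G S, (leafFamily G p a).card ≤ K * Y.card ∧ ∀ X ∈ Y, p ∈ chargers G s X := by
  obtain ⟨a', h1, h3, h4⟩ := hst
  obtain ⟨hsub, hcard, hch⟩ := h.stretch_family hS hs hG hp hu h1 h3
  refine ⟨_, hsub, ?_, fun X hX => (hch X hX).1⟩
  rw [hp.card_leafFamily hG (pathGraph_preconnected s), hcard]
  exact h4.trans (Nat.mul_le_mul_left _ (Nat.le_mul_of_pos_left _ hpos))

/-- The number of neighbours of the unused neighbours of `p t`, not counting `p t`. -/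
noncomputable def childSum {ι : Type*} (G : SimpleGraph V) (p : ι → V) (t : ι) : ℕ :=
  ∑ u ∈ offNbrs G p t, offDeg G (extendBy p u) none

theorem HasSpine.charge_of_childSum {s : ℕ} {a : Fin s → ℕ} (hS : S.IsTree) (hs : 2 ≤ s)
    (h : HasSpine S s a) (hG : G.IsAcyclic) {p : Fin s → V} (hp : IsSkel G (pathGraph s) p)
    {t : Fin s} (hst : HasStretch (childSum G p t) (degIn (pathGraph s) Finset.univ)
      (offDeg G p) a t) :
    ∃ Y ⊆ others G S, (leafFamily G p a).card ≤ Y.card ∧ ∀ X ∈ Y, p ∈ chargers G s X := by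
  classical
  obtain ⟨a', h1, h3, h4⟩ := hst
  have key := fun u (hu : u ∈ offNbrs G p t) => h.stretch_family hS hs hG hp hu h1 h3
  refine ⟨(offNbrs G p t).biUnion fun u => leafFamily G (extendBy p u) (extendBy a' 1), ?_, ?_, ?_⟩
  · exact Finset.biUnion_subset.2 fun u hu => (key u hu).1
  · rw [Finset.card_biUnion, hp.card_leafFamily hG (pathGraph_preconnected s),
      Finset.sum_congr rfl fun u hu => (key u hu).2.1, ← Finset.sum_mul]
    · exact h4
    · intro u hu u' hu' hne
      refine Finset.disjoint_left.2 fun X hX hX' => hne ?_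
      have hr := ((key u hu).2.2 X hX).2.trans ((key u' hu').2.2 X hX').2.symm
      rw [range_extendBy, range_extendBy] at hr
      have : u ∈ insert u' (Set.range p) := hr ▸ Set.mem_insert u _
      exact this.resolve_right (mem_offNbrs.1 hu).2
  · intro X hX
    obtain ⟨u, hu, hX⟩ := Finset.mem_biUnion.1 hX
    exact ((key u hu).2.2 X hX).1

/-- The numerical alternative lets every copy be charged. -/
theorem HasSpine.charge {s : ℕ} {a e : Fin s → ℕ} (hS : S.IsTree) (hs : 2 ≤ s)
    (h : HasSpine S s a) (hG : G.IsTree) (hV : 8 * Fintype.card W < Fintype.card V)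
    {p : Fin s → V} (hp : IsSkel G (pathGraph s) p) (he : offDeg G p = a + e)
    (halt : HasSwap 256 (degIn (pathGraph s) Finset.univ) (a + e) a ∨
      ((∀ i, e i ≤ 5 * a i + 1) ∧ ∀ t, 1 ≤ a t + e t →
        HasStretch 256 (degIn (pathGraph s) Finset.univ) (a + e) a t)) :
    ∃ Y ⊆ others G S, (leafFamily G p a).card ≤ 256 * Y.card ∧ ∀ X ∈ Y, p ∈ chargers G s X := by
  have : NeZero s := ⟨by omega⟩
  rcases halt with hsw | ⟨he5, hst⟩
  · exact h.charge_of_hasSwap hS hG.isAcyclic hp (he ▸ hsw)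
  · have : Nonempty (Fin s) := ⟨⟨0, by omega⟩⟩
    obtain ⟨t, u, hu, hu'⟩ := exists_child (p := p) hG.connected (by
      refine lt_of_le_of_lt ?_ hV
      rw [h.card hS, he, Fintype.card_fin]
      have : ∑ i, (a + e) i ≤ ∑ i, (6 * a i + 1) :=
        Finset.sum_le_sum fun i _ => by have := he5 i; simp only [Pi.add_apply]; omega
      rw [Finset.sum_add_distrib, ← Finset.mul_sum] at this
      simp only [Finset.sum_const, Finset.card_univ, Fintype.card_fin, smul_eq_mul,
        mul_one] at this
      omega)
    refine h.charge_of_hasStretch hS hs hG.isAcyclic hp hu hu' (he ▸ hst t ?_)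
    have : 0 < offDeg G p t := Finset.card_pos.2 ⟨u, hu⟩
    rw [he] at this
    exact this

theorem IsSkel.charge_or {s : ℕ} {a : Fin s → ℕ} (hG : G.IsAcyclic)
    {p : Fin s → V} (hp : IsSkel G (pathGraph s) p) :
    (leafFamily G p a).card = 0 ∨ ∃ e, offDeg G p = a + e := by
  by_cases hle : ∀ i, a i ≤ offDeg G p i
  · exact Or.inr ⟨offDeg G p - a, funext fun i => by
      simp only [Pi.add_apply, Pi.sub_apply]; have := hle i; omega⟩
  · left
    push Not at hle
    obtain ⟨i, hi⟩ := hle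
    rw [hp.card_leafFamily hG (pathGraph_preconnected s)]
    exact Finset.prod_eq_zero (Finset.mem_univ i) (Nat.choose_eq_zero_of_lt hi)

theorem degIn_pathGraph_pos {s : ℕ} (hs : 2 ≤ s) (i : Fin s) :
    1 ≤ degIn (pathGraph s) Finset.univ i := by
  rw [degIn_pathGraph]; split_ifs <;> omega

theorem degIn_pathGraph_le {s : ℕ} (i : Fin s) : degIn (pathGraph s) Finset.univ i ≤ 2 := by
  rw [degIn_pathGraph]; split_ifs <;> omega

theorem HasSpine.card_copies_of_two {s : ℕ} {a : Fin s → ℕ} (hS : S.IsTree) (hs : 2 ≤ s)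
    (h : HasSpine S s a) (hG : G.IsTree) (hV : 8 * Fintype.card W < Fintype.card V)
    {p₀ p₁ : Fin s} (h01 : p₀ ≠ p₁) (h0 : 3 ≤ a p₀ + degIn (pathGraph s) Finset.univ p₀)
    (h1 : 3 ≤ a p₁ + degIn (pathGraph s) Finset.univ p₁) :
    (copies G S).card ≤ 2048 * (others G S).card := by
  classical
  obtain ⟨m, rfl⟩ : ∃ m, s = m + 1 := ⟨s - 1, by omega⟩
  refine h.card_copies_le.trans
    (sum_le_of_charge (K := 256) (M := 8) _ _ (chargers G (m + 1)) _
      (fun X _ => card_chargers_le hG.isAcyclic m X) fun p hp => ?_)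
  rw [mem_allSkels] at hp
  rcases hp.charge_or (a := a) hG.isAcyclic with h00 | ⟨e, he⟩
  · exact ⟨∅, Finset.empty_subset _, by simp [h00], by simp⟩
  · have ha := h.choose_spec.2.2
    exact h.charge hS hs hG hV hp he
      (hasSwap_or_hasStretch (degIn_pathGraph_pos hs) degIn_pathGraph_le ha h01 h0 h1)

end Charge

section Single

variable {ι : Type*} [Fintype ι] [DecidableEq ι] {h a e : ι → ℕ} {c : ι}

/-- The numerical alternative for a single removable vertex with few unused neighbours. -/
theorem hasSwap_or_hasStretch_of_single (hh1 : ∀ i, 1 ≤ h i) (hh : ∀ i, h i ≤ 2)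
    (ha : ∀ i, i ≠ c → a i + h i = 2) (hc : 4 ≤ a c + h c) (hec : e c + 1 ≤ 4 * a c) :
    HasSwap 256 h (a + e) a ∨ ((∀ i, e i ≤ 5 * a i + 1) ∧
      ∀ t, 1 ≤ a t + e t → HasStretch 256 h (a + e) a t) := by
  have hac : 2 ≤ a c := by have := hh c; omega
  have ha2 : ∀ i, 2 ≤ a i + h i := fun i => by
    by_cases hi : i = c
    · subst hi; omega
    · exact (ha i hi).ge
  by_cases hC : ∃ i, i ≠ c ∧ 1 ≤ e i
  · left
    obtain ⟨i, hic, hei⟩ := hC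
    have := ha i hic
    have := hh1 i
    refine hasSwap_single hh ha2 hic.symm (by omega) (by omega) hei ?_
    have : a i + 1 ≤ 2 := by omega
    nlinarith
  · push Not at hC
    have hC' : ∀ i, i ≠ c → e i = 0 := fun i hi => by have := hC i hi; omega
    refine Or.inr ⟨fun i => ?_, fun t ht => ?_⟩
    · by_cases hi : i = c
      · rw [hi]; omega
      · rw [hC' i hi]; omega
    · by_cases htc : t = c
      · subst htc
        refine hasStretch_same ha2 hac ?_
        obtain ⟨k, hk⟩ : ∃ k, a t = k + 2 := ⟨a t - 2, by omega⟩
        calc (a t + e t) * (e t + 1) ≤ (5 * a t) * (4 * a t) := by gcongr; omega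
          _ ≤ 256 * (a t * (a t - 1)) := by
            rw [hk, show k + 2 - 1 = k + 1 by omega]; nlinarith
      · refine hasStretch_ne ha2 (Ne.symm htc) (by omega) (by omega) ?_ ?_
        · have := hC' t htc; omega
        · rw [hC' t htc]; nlinarith

theorem hasSwap_of_many (hh1 : ∀ i, 1 ≤ h i) (hh : ∀ i, h i ≤ 2)
    (ha : ∀ i, i ≠ c → a i + h i = 2) (hc : 4 ≤ a c + h c) {i : ι} (hic : i ≠ c)
    (hec : 4 * a c ≤ e c) (hi : 16 * e c < (a i + e i) * (a c + 1)) :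
    HasSwap 256 h (a + e) a := by
  have hac : 2 ≤ a c := by have := hh c; omega
  have ha2 : ∀ i, 2 ≤ a i + h i := fun i => by
    by_cases hi : i = c
    · subst hi; omega
    · exact (ha i hi).ge
  have h1 := ha i hic
  have h2 := hh1 i
  have hai : a i ≤ 1 := by omega
  have hei : 1 ≤ e i := by
    by_contra h0
    have : e i = 0 := by omega
    rw [this] at hi
    nlinarith
  refine hasSwap_single hh ha2 hic.symm (by omega) (by omega) hei ?_
  have h3 : (a i + e i) * (a c + 1) ≤ (2 * e i) * (2 * a c) := by gcongr <;> omega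
  have h4 : (a i + 1) * (e c + 1) ≤ 2 * (2 * e c) := by gcongr <;> omega
  nlinarith

end Single

section Tail

variable {V : Type*} {G : SimpleGraph V}

theorem degIn_pathGraph_succ (m : ℕ) (i : Fin (m + 1)) :
    degIn (pathGraph (m + 2)) Finset.univ i.succ
      = degIn (pathGraph (m + 1)) Finset.univ i + (Pi.single 0 1 : Fin (m + 1) → ℕ) i := by
  rw [degIn_pathGraph, degIn_pathGraph]
  by_cases hi : i = 0
  · subst hi; simp [add_comm]
  · have : 0 < i.1 := Nat.pos_of_ne_zero fun h => hi (Fin.ext h)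
    simp [hi, this]

theorem IsSkel.tail {m : ℕ} {p : Fin (m + 1) → V} (hp : IsSkel G (pathGraph (m + 1)) p) :
    IsSkel G (pathGraph m) (Fin.tail p) where
  inj := fun i j h => Fin.succ_injective _ (hp.inj h)
  adj := fun i j h => hp.adj _ _ (by rw [pathGraph_adj] at *; simpa using h)

theorem range_eq_extendBy_tail {m : ℕ} (p : Fin (m + 1) → V) :
    Set.range p = Set.range (extendBy (Fin.tail p) (p 0)) := by
  rw [range_extendBy]
  ext x
  constructor
  · rintro ⟨i, rfl⟩
    refine Fin.cases (Or.inl rfl) (fun j => Or.inr ⟨j, rfl⟩) i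
  · rintro (rfl | ⟨j, rfl⟩)
    · exact ⟨0, rfl⟩
    · exact ⟨j.succ, rfl⟩

variable [Fintype V]

theorem offDeg_zero_eq {m : ℕ} (p : Fin (m + 1) → V) :
    offDeg G p 0 = offDeg G (extendBy (Fin.tail p) (p 0)) none := by
  classical
  refine congrArg Finset.card ?_
  ext x
  rw [mem_offNbrs, mem_offNbrs, range_eq_extendBy_tail p]
  rfl

theorem offDeg_succ_eq {m : ℕ} (p : Fin (m + 1) → V) (i : Fin m) :
    offDeg G p i.succ = offDeg G (extendBy (Fin.tail p) (p 0)) (some i) := by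
  classical
  refine congrArg Finset.card ?_
  ext x
  rw [mem_offNbrs, mem_offNbrs, range_eq_extendBy_tail p]
  rfl

theorem IsSkel.head_mem {m : ℕ} {p : Fin (m + 2) → V} (hp : IsSkel G (pathGraph (m + 2)) p) :
    p 0 ∈ offNbrs G (Fin.tail p) 0 := by
  rw [mem_offNbrs]
  refine ⟨hp.adj _ _ (pathGraph_adj.2 (Or.inr (by simp))), ?_⟩
  rintro ⟨i, hi⟩
  exact Fin.succ_ne_zero i (hp.inj hi)

theorem IsSkel.chooseProd_tail {m : ℕ} {p : Fin (m + 2) → V} (hG : G.IsAcyclic)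
    (hp : IsSkel G (pathGraph (m + 2)) p) {a : Fin (m + 2) → ℕ} (ha0 : a 0 = 1) :
    chooseProd (offDeg G p) a = offDeg G p 0 *
      chooseProd (offDeg G (Fin.tail p) - Pi.single 0 1) (Fin.tail a) := by
  rw [chooseProd, Fin.prod_univ_succ, ha0, Nat.choose_one_right]
  congr 1
  refine Finset.prod_congr rfl fun i _ => ?_
  rw [offDeg_succ_eq, hp.tail.offDeg_extendBy_some hG (pathGraph_preconnected _) hp.head_mem]
  rfl

/-- The children of `u` do not change when the head of the path is removed. -/
theorem IsSkel.offDeg_extendBy_tail {m : ℕ} {p : Fin (m + 2) → V} (hG : G.IsAcyclic)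
    (hp : IsSkel G (pathGraph (m + 2)) p) {u : V} (hu : u ∈ offNbrs G p 1) :
    offDeg G (extendBy p u) none = offDeg G (extendBy (Fin.tail p) u) none := by
  classical
  refine congrArg Finset.card ?_
  rw [mem_offNbrs] at hu
  have h0 : ¬ G.Adj u (p 0) := fun h => by
    have := hp.eq_of_adj_off hG (pathGraph_preconnected _) hu.2 hu.1 h.symm
    simp at this
  ext x
  rw [mem_offNbrs, mem_offNbrs, range_extendBy, range_extendBy, range_eq_extendBy_tail p,
    range_extendBy]
  refine and_congr_right fun hx => not_congr ?_
  have hx' : x ≠ p 0 := by rintro rfl; exact h0 hx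
  simp [hx']

theorem IsSkel.offNbrs_tail {m : ℕ} {p : Fin (m + 2) → V} [DecidableEq V]
    (hp : IsSkel G (pathGraph (m + 2)) p) :
    offNbrs G (Fin.tail p) 0 = insert (p 0) (offNbrs G p 1) := by
  ext x
  rw [Finset.mem_insert, mem_offNbrs, mem_offNbrs, range_eq_extendBy_tail p, range_extendBy]
  by_cases hx : x = p 0
  · subst hx
    have := mem_offNbrs.1 hp.head_mem
    simpa using this
  · simp only [hx, false_or, Set.mem_insert_iff]
    exact Iff.rfl

theorem IsSkel.childSum_tail {m : ℕ} {p : Fin (m + 2) → V} (hG : G.IsAcyclic)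
    (hp : IsSkel G (pathGraph (m + 2)) p) :
    childSum G (Fin.tail p) 0 = offDeg G p 0 + childSum G p 1 := by
  classical
  rw [childSum, hp.offNbrs_tail, Finset.sum_insert, ← offDeg_zero_eq, childSum]
  · congr 1
    exact Finset.sum_congr rfl fun u hu => (hp.offDeg_extendBy_tail hG hu).symm
  · rw [mem_offNbrs]
    exact fun h => h.2 ⟨0, rfl⟩

theorem sum_tail_fiber_le {m : ℕ} (P : Finset (Fin (m + 2) → V))
    (hP : ∀ p ∈ P, IsSkel G (pathGraph (m + 2)) p) (t : Fin (m + 1) → V)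
    (ht : ∀ p ∈ P, Fin.tail p = t) (f : V → ℕ) :
    ∑ p ∈ P, f (p 0) ≤ ∑ v ∈ offNbrs G t 0, f v := by
  classical
  have hinj : Set.InjOn (fun p : Fin (m + 2) → V => p 0) P := by
    intro p hp p' hp' h
    rw [← Fin.cons_self_tail p, ← Fin.cons_self_tail p', ht p hp, ht p' hp']
    exact congrArg (fun v => (Fin.cons v t : Fin (m + 2) → V)) h
  rw [← Finset.sum_image (f := f) hinj]
  refine Finset.sum_le_sum_of_subset fun v hv => ?_
  obtain ⟨p, hp, rfl⟩ := Finset.mem_image.1 hv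
  rw [← ht p hp]
  exact (hP p hp).head_mem

/-- The leaf vector for the tail of a spine. -/
def tailVec {m : ℕ} (a : Fin (m + 2) → ℕ) (j : Fin (m + 1)) : Fin (m + 1) → ℕ :=
  Fin.tail a + Pi.single 0 1 + Pi.single j 1

theorem sum_tailVec {m : ℕ} (a : Fin (m + 2) → ℕ) (ha0 : a 0 = 1) (j : Fin (m + 1)) :
    m + 1 + ∑ i, tailVec a j i = m + 2 + ∑ i, a i := by
  rw [tailVec, sum_add_single, sum_add_single, Fin.sum_univ_succ a, ha0]
  change m + 1 + (∑ i, a (Fin.succ i) + 1 + 1) = _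
  omega

theorem tail_fiber_le_of_ne {m : ℕ} {a : Fin (m + 2) → ℕ} (hG : G.IsAcyclic) (ha0 : a 0 = 1)
    (ha1 : a 1 = 0) {j : Fin (m + 1)} (hj : j ≠ 0) (P : Finset (Fin (m + 2) → V))
    (hP : ∀ p ∈ P, IsSkel G (pathGraph (m + 2)) p) (t : Fin (m + 1) → V)
    (ht : ∀ p ∈ P, Fin.tail p = t)
    (hleft : ∀ p ∈ P, offDeg G p 0 * (a j.succ + 1) ≤ 16 * (offDeg G p j.succ - a j.succ)) :
    ∑ p ∈ P, (leafFamily G p a).card ≤ 16 * (leafFamily G t (tailVec a j)).card := by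
  rcases P.eq_empty_or_nonempty with rfl | ⟨p₁, hp₁⟩
  · simp
  have htskel : IsSkel G (pathGraph (m + 1)) t := ht p₁ hp₁ ▸ (hP p₁ hp₁).tail
  have hpre := pathGraph_preconnected (m + 1)
  set α := Fin.tail a with hα
  set D := offDeg G t with hD
  have hα0 : α 0 = 0 := ha1
  have h0 : D 0 ≠ 0 := by
    have h1 := (hP p₁ hp₁).head_mem
    rw [ht p₁ hp₁] at h1
    exact Finset.card_ne_zero_of_mem h1
  have e1 := chooseProd_sub_single D α 0
  rw [hα0, Nat.sub_zero] at e1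
  have e1' := Nat.eq_of_mul_eq_mul_right (Nat.pos_of_ne_zero h0) e1
  have e2 := chooseProd_add_single D α 0
  rw [hα0, Nat.sub_zero, zero_add, mul_one] at e2
  have e3 := chooseProd_add_single D (α + Pi.single 0 1) j
  simp only [Pi.add_apply, Pi.single_eq_of_ne hj, add_zero] at e3
  rw [htskel.card_leafFamily hG hpre]
  refine Nat.le_of_mul_le_mul_right (c := α j + 1) ?_ (by omega)
  rw [tailVec, mul_assoc, e3, e2, Finset.sum_mul]
  calc ∑ p ∈ P, (leafFamily G p a).card * (α j + 1)
      ≤ ∑ p ∈ P, 16 * (D j - α j) * chooseProd D α := by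
        refine Finset.sum_le_sum fun p hp => ?_
        have hs := hP p hp
        have hl := hleft p hp
        rw [offDeg_succ_eq, hs.tail.offDeg_extendBy_some hG hpre hs.head_mem, ht p hp] at hl
        simp only [Pi.sub_apply, Pi.single_eq_of_ne hj, Nat.sub_zero] at hl
        rw [hs.card_leafFamily hG (pathGraph_preconnected _), hs.chooseProd_tail hG ha0, ht p hp,
          ← hD, ← hα, e1']
        calc offDeg G p 0 * chooseProd D α * (α j + 1)
            = offDeg G p 0 * (α j + 1) * chooseProd D α := by ring
          _ ≤ 16 * (D j - α j) * chooseProd D α := Nat.mul_le_mul_right _ hl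
    _ = (∑ p ∈ P, 1) * (16 * (D j - α j) * chooseProd D α) := by
        rw [Finset.sum_const, Finset.sum_const, smul_eq_mul, smul_eq_mul, mul_one]
    _ ≤ D 0 * (16 * (D j - α j) * chooseProd D α) := by
        refine Nat.mul_le_mul_right _ ((sum_tail_fiber_le P hP t ht fun _ => 1).trans_eq ?_)
        rw [Finset.sum_const, smul_eq_mul, mul_one]; rfl
    _ = 16 * (chooseProd D α * D 0 * (D j - α j)) := by ring

theorem tail_fiber_le_zero {m : ℕ} {a : Fin (m + 2) → ℕ} (hG : G.IsAcyclic) (ha0 : a 0 = 1)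
    (ha1 : 2 ≤ a 1) (P : Finset (Fin (m + 2) → V))
    (hP : ∀ p ∈ P, IsSkel G (pathGraph (m + 2)) p) (t : Fin (m + 1) → V)
    (ht : ∀ p ∈ P, Fin.tail p = t)
    (hle : ∀ p ∈ P, 5 * a 1 ≤ offDeg G p 1)
    (hleft : ∀ p ∈ P, offDeg G p 0 * (a 1 + 1) ≤ 16 * (offDeg G p 1 - a 1))
    (hbad : ∀ p ∈ P, childSum G p 1 * (a 1 * (a 1 - 1))
      ≤ offDeg G p 1 * (offDeg G p 1 - a 1 + 1)) :
    ∑ p ∈ P, (leafFamily G p a).card ≤ 28 * (leafFamily G t (tailVec a 0)).card := by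
  rcases P.eq_empty_or_nonempty with rfl | ⟨p₁, hp₁⟩
  · simp
  have htskel : IsSkel G (pathGraph (m + 1)) t := ht p₁ hp₁ ▸ (hP p₁ hp₁).tail
  have hpre := pathGraph_preconnected (m + 1)
  set α := Fin.tail a with hα
  set D := offDeg G t with hD
  have hα0 : α 0 = a 1 := rfl
  have hDp : offDeg G p₁ 1 = D 0 - 1 := by
    have hs := hP p₁ hp₁
    have := offDeg_succ_eq (G := G) p₁ 0
    rw [hs.tail.offDeg_extendBy_some hG hpre hs.head_mem, ht p₁ hp₁] at this
    simpa using this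
  have e1 := chooseProd_sub_single D α 0
  have e2 := chooseProd_add_single D α 0
  have e3 := chooseProd_add_single D (α + Pi.single 0 1) 0
  simp only [Pi.add_apply, Pi.single_eq_same] at e3
  have hle₁ := hle p₁ hp₁
  have hleft₁ := hleft p₁ hp₁
  have hbad₁ := hbad p₁ hp₁
  have hcs := (hP p₁ hp₁).childSum_tail hG
  rw [ht p₁ hp₁] at hcs
  have hsum : ∑ p ∈ P, (leafFamily G p a).card
      ≤ childSum G t 0 * chooseProd (D - Pi.single 0 1) α := by
    calc ∑ p ∈ P, (leafFamily G p a).card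
        = ∑ p ∈ P, offDeg G (extendBy t (p 0)) none * chooseProd (D - Pi.single 0 1) α := by
          refine Finset.sum_congr rfl fun p hp => ?_
          have hs := hP p hp
          rw [hs.card_leafFamily hG (pathGraph_preconnected _), hs.chooseProd_tail hG ha0, ht p hp,
            offDeg_zero_eq, ht p hp]
      _ = (∑ p ∈ P, offDeg G (extendBy t (p 0)) none) * chooseProd (D - Pi.single 0 1) α := by
          rw [Finset.sum_mul]
      _ ≤ _ := Nat.mul_le_mul_right _ (sum_tail_fiber_le P hP t ht fun v =>
          offDeg G (extendBy t v) none)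
  refine hsum.trans ?_
  rw [htskel.card_leafFamily hG hpre, tailVec, ← hα]
  obtain ⟨k, hk⟩ : ∃ k, a 1 = k + 2 := ⟨a 1 - 2, by omega⟩
  obtain ⟨e, he⟩ : ∃ e, offDeg G p₁ 1 = k + 2 + e := ⟨offDeg G p₁ 1 - (k + 2), by omega⟩
  have hD0 : D 0 = k + 2 + e + 1 := by omega
  rw [hα0, hk] at e1 e2 e3
  rw [hD0] at e1 e2 e3
  rw [hk, he] at hle₁ hleft₁ hbad₁
  generalize offDeg G p₁ 0 = x at *
  generalize childSum G p₁ 1 = y at *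
  generalize childSum G t 0 = z at *
  generalize chooseProd (D - Pi.single 0 1) α = Q at *
  rw [show k + 2 + e - (k + 2) = e by omega] at hleft₁ hbad₁
  rw [show k + 2 - 1 = k + 1 by omega] at hbad₁
  rw [show k + 2 + e + 1 - (k + 2) = e + 1 by omega] at e1 e2
  rw [show k + 2 + e + 1 - (k + 2 + 1) = e by omega] at e3
  have hkey : z * ((k + 3) * (k + 4)) ≤ 28 * ((k + 2 + e + 1) * e) := by
    rw [hcs, add_mul]
    have h1 : x * ((k + 3) * (k + 4)) ≤ 16 * e * (k + 2 + e + 1) := by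
      calc x * ((k + 3) * (k + 4)) = (x * (k + 2 + 1)) * (k + 4) := by ring
        _ ≤ 16 * e * (k + 2 + e + 1) := Nat.mul_le_mul hleft₁ (by omega)
    have h2 : y * ((k + 3) * (k + 4)) ≤ 6 * (2 * ((k + 2 + e) * e)) := by
      calc y * ((k + 3) * (k + 4)) ≤ y * (6 * ((k + 2) * (k + 1))) :=
            Nat.mul_le_mul_left _ (by nlinarith)
        _ = 6 * (y * ((k + 2) * (k + 1))) := by ring
        _ ≤ 6 * ((k + 2 + e) * (e + 1)) := Nat.mul_le_mul_left _ hbad₁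
        _ ≤ 6 * ((k + 2 + e) * (2 * e)) := by gcongr; omega
        _ = 6 * (2 * ((k + 2 + e) * e)) := by ring
    nlinarith
  have hp0 : Q * (k + 2 + e + 1) * e = chooseProd D (α + Pi.single 0 1 + Pi.single 0 1)
      * ((k + 3) * (k + 4)) := by
    calc Q * (k + 2 + e + 1) * e = chooseProd D α * (e + 1) * e := by rw [e1]
      _ = chooseProd D (α + Pi.single 0 1) * e * (k + 3) := by rw [← e2]; ring
      _ = _ := by rw [← e3]; ring
  refine Nat.le_of_mul_le_mul_right (c := (k + 3) * (k + 4)) ?_ (by positivity)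
  calc z * Q * ((k + 3) * (k + 4)) = z * ((k + 3) * (k + 4)) * Q := by ring
    _ ≤ 28 * ((k + 2 + e + 1) * e) * Q := Nat.mul_le_mul_right _ hkey
    _ = 28 * (Q * (k + 2 + e + 1) * e) := by ring
    _ = _ := by rw [hp0]; ring

end Tail

section Single

variable {V W : Type*} [Fintype W] [Fintype V] {G : SimpleGraph V} {S : SimpleGraph W}

theorem degIn_pathGraph_rev {s : ℕ} (i : Fin s) :
    degIn (pathGraph s) Finset.univ i.rev = degIn (pathGraph s) Finset.univ i := by
  rw [degIn_pathGraph, degIn_pathGraph, Fin.val_rev]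
  have := i.2
  split_ifs <;> omega

theorem HasSpine.rev {s : ℕ} {a : Fin s → ℕ} (h : HasSpine S s a) :
    HasSpine S s (a ∘ Fin.rev) := by
  classical
  obtain ⟨q, hq, hu, ha⟩ := h
  have hr : Set.range (q ∘ Fin.rev) = Set.range q := Fin.rev_surjective.range_comp q
  have ho : ∀ i, offNbrs S (q ∘ Fin.rev) i = offNbrs S q i.rev := fun i => by
    ext x
    rw [mem_offNbrs, mem_offNbrs, hr]
    rfl
  refine ⟨q ∘ Fin.rev, ⟨hq.inj.comp Fin.rev_injective, fun i j hij => hq.adj _ _ ?_⟩, ?_, ?_⟩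
  · rw [pathGraph_adj] at *
    rw [Fin.val_rev, Fin.val_rev]
    omega
  · rw [mem_leafFamily] at *
    refine ⟨fun i => Finset.mem_univ _, fun x hx => ?_, fun i => ?_⟩
    · rw [hr]
      refine (hu.2.1 x hx).imp_right ?_
      rintro ⟨i, hi⟩
      exact ⟨i.rev, by rwa [ho, Fin.rev_rev]⟩
    · rw [ho]
      exact hu.2.2 _
  · intro i
    rw [← degIn_pathGraph_rev]
    exact ha i.rev

theorem two_le_tailVec_add {m : ℕ} {a : Fin (m + 2) → ℕ}
    (ha : ∀ i, 2 ≤ a i + degIn (pathGraph (m + 2)) Finset.univ i) (j i : Fin (m + 1)) :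
    2 ≤ tailVec a j i + degIn (pathGraph (m + 1)) Finset.univ i := by
  have := ha i.succ
  rw [degIn_pathGraph_succ] at this
  simp only [tailVec, Pi.add_apply, Fin.tail]
  omega

theorem HasSpine.sum_tailFamily_le {m : ℕ} {a : Fin (m + 2) → ℕ} (hS : S.IsTree)
    (h : HasSpine S (m + 2) a) (hG : G.IsAcyclic) (ha0 : a 0 = 1) (j : Fin (m + 1)) :
    ∑ t ∈ allSkels G (m + 1), (leafFamily G t (tailVec a j)).card ≤ 2 * (others G S).card := by
  classical
  have hH := pathGraph_connected m
  have hb := fun i => two_le_tailVec_add h.choose_spec.2.2 j i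
  refine (sum_le_of_charge (K := 1) (M := 2) _ _ (fun X => pathSkels G (m + 1) (innerSet G X)) _
    (fun X _ => card_pathSkels_le hG m _) fun t ht => ?_).trans_eq (by ring)
  rw [mem_allSkels] at ht
  refine ⟨leafFamily G t (tailVec a j), ?_, by rw [one_mul], fun X hX => ?_⟩
  · refine h.family_subset_others_of_ne hS hG hH ht ?_ hb (by simp)
    rw [Fintype.card_fin, sum_tailVec a ha0]
  · simp only [pathSkels, Finset.mem_filter, Finset.mem_univ, true_and]
    exact ⟨ht, ht.range_eq hG hH.preconnected hX hb⟩

/-- The alternatives for one skeleton when a single spine vertex has many leaves. -/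
theorem HasSpine.charge_or_of_single {m : ℕ} {a : Fin (m + 2) → ℕ} (hS : S.IsTree)
    (h : HasSpine S (m + 2) a) (hG : G.IsTree) (hV : 8 * Fintype.card W < Fintype.card V)
    {c : Fin (m + 2)} (hc0 : c ≠ 0)
    (ha : ∀ i, i ≠ c → a i + degIn (pathGraph (m + 2)) Finset.univ i = 2)
    (hc : 4 ≤ a c + degIn (pathGraph (m + 2)) Finset.univ c) (ha0 : a 0 = 1)
    {p : Fin (m + 2) → V} (hp : IsSkel G (pathGraph (m + 2)) p) :
    (∃ Y ⊆ others G S, (leafFamily G p a).card ≤ 256 * Y.card ∧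
      ∀ X ∈ Y, p ∈ chargers G (m + 2) X) ∨
    (offDeg G p 0 * (a c + 1) ≤ 16 * (offDeg G p c - a c) ∧ 5 * a c ≤ offDeg G p c ∧
      childSum G p c * (a c * (a c - 1)) ≤ offDeg G p c * (offDeg G p c - a c + 1)) := by
  have hs : 2 ≤ m + 2 := by omega
  have ha2 := h.choose_spec.2.2
  rcases hp.charge_or (a := a) hG.isAcyclic with h00 | ⟨e, he⟩
  · exact Or.inl ⟨∅, Finset.empty_subset _, by simp [h00], by simp⟩
  have hh1 := degIn_pathGraph_pos hs
  have hh := degIn_pathGraph_le (s := m + 2)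
  have hac : 2 ≤ a c := by have := hh c; omega
  by_cases h1 : e c + 1 ≤ 4 * a c
  · exact Or.inl (h.charge hS hs hG hV hp he (hasSwap_or_hasStretch_of_single hh1 hh ha hc h1))
  by_cases h2 : 16 * e c < (a 0 + e 0) * (a c + 1)
  · exact Or.inl (h.charge hS hs hG hV hp he
      (Or.inl (hasSwap_of_many hh1 hh ha hc hc0.symm (by omega) h2)))
  by_cases h3 : (a c + e c) * (e c + 1) ≤ childSum G p c * (a c * (a c - 1))
  · obtain ⟨Y, hY, hY', hY''⟩ := h.charge_of_childSum hS hs hG.isAcyclic hp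
      (he ▸ hasStretch_same ha2 hac h3)
    exact Or.inl ⟨Y, hY, by omega, hY''⟩
  · right
    rw [he]
    simp only [Pi.add_apply, Nat.add_sub_cancel_left]
    rw [ha0] at h2
    exact ⟨by rw [ha0]; omega, by omega, by omega⟩

theorem HasSpine.card_copies_of_single_ne_zero {m : ℕ} {a : Fin (m + 2) → ℕ} (hS : S.IsTree)
    (h : HasSpine S (m + 2) a) (hG : G.IsTree) (hV : 8 * Fintype.card W < Fintype.card V)
    {c : Fin (m + 2)} (hc0 : c ≠ 0)
    (ha : ∀ i, i ≠ c → a i + degIn (pathGraph (m + 2)) Finset.univ i = 2)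
    (hc : 4 ≤ a c + degIn (pathGraph (m + 2)) Finset.univ c) :
    (copies G S).card ≤ 2104 * (others G S).card := by
  classical
  have ha0 : a 0 = 1 := by
    have := ha 0 hc0.symm
    rw [degIn_pathGraph] at this
    simpa using this
  obtain ⟨j, rfl⟩ := Fin.exists_succ_eq.2 hc0
  have hac : 2 ≤ a j.succ := by have := degIn_pathGraph_le (s := m + 2) j.succ; omega
  have hdich := fun p (hp : p ∈ allSkels G (m + 2)) =>
    h.charge_or_of_single hS hG hV hc0 ha hc ha0 (mem_allSkels.1 hp)
  set Q : (Fin (m + 2) → V) → Prop := fun p => ∃ Y ⊆ others G S,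
    (leafFamily G p a).card ≤ 256 * Y.card ∧ ∀ X ∈ Y, p ∈ chargers G (m + 2) X with hQ
  have hgood : ∑ p ∈ (allSkels G (m + 2)).filter Q, (leafFamily G p a).card
      ≤ 256 * 8 * (others G S).card :=
    sum_le_of_charge _ _ (chargers G (m + 2)) _
      (fun X _ => card_chargers_le hG.isAcyclic (m + 1) X) fun p hp => (Finset.mem_filter.1 hp).2
  set B := (allSkels G (m + 2)).filter fun p => ¬ Q p with hB
  have hBmem : ∀ p ∈ B, p ∈ allSkels G (m + 2) ∧ ¬ Q p := fun p hp => Finset.mem_filter.1 hp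
  have hmaps : ∀ p ∈ B, Fin.tail p ∈ allSkels G (m + 1) := fun p hp =>
    mem_allSkels.2 (mem_allSkels.1 (hBmem p hp).1).tail
  have hbad : ∑ p ∈ B, (leafFamily G p a).card ≤ 28 * (2 * (others G S).card) := by
    rw [← Finset.sum_fiberwise_of_maps_to hmaps]
    refine le_trans (Finset.sum_le_sum fun t _ => ?_)
      ((Finset.mul_sum _ _ _).symm.trans_le
        (Nat.mul_le_mul_left 28 (h.sum_tailFamily_le hS hG.isAcyclic ha0 j)))
    have hP : ∀ p ∈ B.filter fun p => Fin.tail p = t, IsSkel G (pathGraph (m + 2)) p :=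
      fun p hp => mem_allSkels.1 (hBmem p (Finset.mem_filter.1 hp).1).1
    have ht : ∀ p ∈ B.filter fun p => Fin.tail p = t, Fin.tail p = t :=
      fun p hp => (Finset.mem_filter.1 hp).2
    have hl := fun p (hp : p ∈ B.filter fun p => Fin.tail p = t) =>
      have hp' := hBmem p (Finset.mem_filter.1 hp).1
      (hdich p hp'.1).resolve_left hp'.2
    by_cases hj : j = 0
    · subst hj
      exact tail_fiber_le_zero hG.isAcyclic ha0 hac _ hP t ht (fun p hp => (hl p hp).2.1)
        (fun p hp => (hl p hp).1) (fun p hp => (hl p hp).2.2)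
    · have hm : 0 < m := by
        rcases Nat.eq_zero_or_pos m with rfl | hm
        · exact absurd (Subsingleton.elim (α := Fin 1) j 0) hj
        · exact hm
      have ha1 : a 1 = 0 := by
        have h1 := ha 1 fun h1 => hj (Fin.succ_injective _ h1.symm)
        rw [degIn_pathGraph] at h1
        simp [hm] at h1
        omega
      refine (tail_fiber_le_of_ne hG.isAcyclic ha0 ha1 hj _ hP t ht
        (fun p hp => (hl p hp).1)).trans (Nat.mul_le_mul_right _ (by norm_num))
  have hsum : ∑ p ∈ (allSkels G (m + 2)).filter Q, (leafFamily G p a).card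
      + ∑ p ∈ B, (leafFamily G p a).card = ∑ p ∈ allSkels G (m + 2), (leafFamily G p a).card :=
    Finset.sum_filter_add_sum_filter_not _ _ _
  have := h.card_copies_le (G := G)
  omega

theorem HasSpine.card_copies_of_single {s : ℕ} {a : Fin s → ℕ} (hS : S.IsTree) (hs : 2 ≤ s)
    (h : HasSpine S s a) (hG : G.IsTree) (hV : 8 * Fintype.card W < Fintype.card V)
    {c : Fin s} (ha : ∀ i, i ≠ c → a i + degIn (pathGraph s) Finset.univ i = 2)
    (hc : 4 ≤ a c + degIn (pathGraph s) Finset.univ c) :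
    (copies G S).card ≤ 2104 * (others G S).card := by
  obtain ⟨m, rfl⟩ : ∃ m, s = m + 2 := ⟨s - 2, by omega⟩
  by_cases hc0 : c = 0
  · subst hc0
    refine h.rev.card_copies_of_single_ne_zero hS hG hV (c := Fin.last (m + 1)) ?_ ?_ ?_
    · exact Fin.last_pos.ne'
    · intro i hi
      rw [← degIn_pathGraph_rev]
      refine ha i.rev fun h0 => hi ?_
      rw [← Fin.rev_rev i, h0, Fin.rev_zero]
    · rw [← degIn_pathGraph_rev]
      simpa using hc
  · exact h.card_copies_of_single_ne_zero hS hG hV hc0 ha hc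

end Single

theorem chooseProd_zero {ι : Type*} [Fintype ι] {D : ι → ℕ} : chooseProd D 0 = 1 := by
  simp [chooseProd]

section Three

variable {ι : Type*} [Fintype ι] [DecidableEq ι] {h a e D : ι → ℕ} {c f l : ι}

/-- The leaf vector `a` can be exchanged for one with a different degree square sum, losing at
most a factor `K`. -/
def HasWeakSwap (K : ℕ) (h D a : ι → ℕ) : Prop :=
  ∃ b : ι → ℕ, ∑ i, b i = ∑ i, a i ∧ ∑ i, (b i + h i) ^ 2 ≠ ∑ i, (a i + h i) ^ 2 ∧
    chooseProd D a ≤ K * chooseProd D b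

theorem hasWeakSwap_single {K : ℕ} {p q : ι} (hpq : p ≠ q) (hap : 1 ≤ a p)
    (hd : a p + h p ≠ a q + h q + 1) (hq : 1 ≤ e q)
    (hK : (a q + 1) * (e p + 1) ≤ K * (a p * e q)) : HasWeakSwap K h (a + e) a := by
  obtain ⟨b, rfl⟩ := exists_eq_add_single hap
  simp only [Pi.add_apply, Pi.single_eq_same, Pi.single_eq_of_ne hpq.symm, add_zero] at *
  refine ⟨b + Pi.single q 1, ?_, ?_, ?_⟩
  · rw [sum_add_single, sum_add_single]
  · have h1 := sum_sq_add_single b h p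
    have h2 := sum_sq_add_single b h q
    omega
  · refine chooseProd_move _ b p q ?_ ?_
    · simp only [Pi.add_apply, Pi.single_eq_of_ne hpq.symm]
      exact Nat.mul_pos (by omega) (by omega)
    · simp only [Pi.add_apply, Pi.single_eq_of_ne hpq.symm, Pi.single_eq_same]
      rw [show b p + 1 + e p - b p = e p + 1 by omega, show b q + 0 + e q - b q = e q by omega]
      exact hK

theorem chooseProd_triple (f : ι) :
    chooseProd D (0 + Pi.single f 1 + Pi.single f 1 + Pi.single f 1) * 6
      = D f * (D f - 1) * (D f - 2) := by
  have h1 := chooseProd_add_single D 0 f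
  have h2 := chooseProd_add_single D (0 + Pi.single f 1) f
  have h3 := chooseProd_add_single D (0 + Pi.single f 1 + Pi.single f 1) f
  rw [chooseProd_zero] at h1
  simp only [Pi.add_apply, Pi.zero_apply, Pi.single_eq_same] at h1 h2 h3
  simp only [zero_add, Nat.reduceAdd, one_mul, mul_one, Nat.sub_zero] at *
  rw [h1] at h2
  rw [← h2]
  linear_combination 2 * h3

theorem chooseProd_distinct (hfl : f ≠ l) (hfc : f ≠ c) (hlc : l ≠ c) :
    chooseProd D (0 + Pi.single f 1 + Pi.single l 1 + Pi.single c 1) = D f * D l * D c := by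
  have h1 := chooseProd_add_single D 0 f
  have h2 := chooseProd_add_single D (0 + Pi.single f 1) l
  have h3 := chooseProd_add_single D (0 + Pi.single f 1 + Pi.single l 1) c
  rw [chooseProd_zero] at h1
  simp only [Pi.add_apply, Pi.zero_apply, Pi.single_eq_of_ne hfl.symm,
    Pi.single_eq_of_ne hfc.symm, Pi.single_eq_of_ne hlc.symm] at h1 h2 h3
  simp only [zero_add, one_mul, mul_one, Nat.sub_zero] at *
  rw [h3, h2, h1]

theorem chooseProd_pair (hfc : f ≠ c) :
    chooseProd D (0 + Pi.single f 1 + Pi.single c 1 + Pi.single c 1) * 2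
      = D f * D c * (D c - 1) := by
  have h1 := chooseProd_add_single D 0 f
  have h2 := chooseProd_add_single D (0 + Pi.single f 1) c
  have h3 := chooseProd_add_single D (0 + Pi.single f 1 + Pi.single c 1) c
  rw [chooseProd_zero] at h1
  simp only [Pi.add_apply, Pi.zero_apply, Pi.single_eq_same,
    Pi.single_eq_of_ne hfc.symm] at h1 h2 h3
  simp only [zero_add, one_mul, mul_one, Nat.sub_zero, Nat.reduceAdd] at *
  rw [h3, h2, h1]

theorem hasWeakSwap_triple_interior (hfl : f ≠ l) (hfc : f ≠ c) (hlc : l ≠ c)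
    (ha : a = 0 + Pi.single f 1 + Pi.single l 1 + Pi.single c 1)
    (hf : h f = 1) (hl : h l = 1) (hc : h c = 2) (hle : e l ≤ e f) (hef : 2 ≤ e f)
    (hec : 4 * e c < e f + 1) : HasWeakSwap 12 h (a + e) a := by
  refine ⟨0 + Pi.single f 1 + Pi.single f 1 + Pi.single f 1, ?_, ?_, ?_⟩
  · rw [ha]
    simp only [sum_add_single]
  · rw [ha]
    iterate 6 rw [sum_sq_add_single]
    simp only [Pi.add_apply, Pi.zero_apply, Pi.single_eq_same,
      Pi.single_eq_of_ne hfl.symm, Pi.single_eq_of_ne hfc.symm, Pi.single_eq_of_ne hlc.symm]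
    omega
  · have h1 := chooseProd_triple (D := a + e) f
    have h2 := chooseProd_distinct (D := a + e) hfl hfc hlc
    rw [← ha] at h2
    rw [h2]
    have af : a f = 1 := by simp [ha, hfl, hfc]
    have al : a l = 1 := by simp [ha, hfl.symm, hlc]
    have ac : a c = 1 := by simp [ha, hfc.symm, hlc.symm]
    simp only [Pi.add_apply, af, al, ac] at h1 h2 ⊢
    obtain ⟨y, hy⟩ : ∃ y, e f = y + 2 := ⟨e f - 2, by omega⟩
    rw [hy] at h1 ⊢ hec hle
    rw [show 1 + (y + 2) - 1 = y + 2 by omega, show 1 + (y + 2) - 2 = y + 1 by omega] at h1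
    have h3 : (1 + e l) * (1 + e c) * 6 ≤ 12 * ((y + 2) * (y + 1)) := by
      rcases Nat.eq_zero_or_pos y with rfl | hy0
      · have : e c = 0 := by omega
        rw [this]; omega
      · have h4 : 4 * (1 + e c) ≤ 7 * y := by omega
        have h5 : (1 + e l) * (4 * (1 + e c)) ≤ (y + 3) * (7 * y) :=
          Nat.mul_le_mul (by omega) h4
        nlinarith
    refine Nat.le_of_mul_le_mul_right (c := 6) ?_ (by norm_num)
    calc (1 + (y + 2)) * (1 + e l) * (1 + e c) * 6
        = (1 + (y + 2)) * ((1 + e l) * (1 + e c) * 6) := by ring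
      _ ≤ (1 + (y + 2)) * (12 * ((y + 2) * (y + 1))) := Nat.mul_le_mul_left _ h3
      _ = _ := by linear_combination 12 * h1.symm

theorem hasWeakSwap_triple_end (hfc : f ≠ c)
    (ha : a = 0 + Pi.single f 1 + Pi.single c 1 + Pi.single c 1)
    (hf : h f = 1) (hc : h c = 1) (hef : 2 ≤ e f)
    (hec : 4 * e c < e f + 1) : HasWeakSwap 12 h (a + e) a := by
  refine ⟨0 + Pi.single f 1 + Pi.single f 1 + Pi.single f 1, ?_, ?_, ?_⟩
  · rw [ha]
    simp only [sum_add_single]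
  · rw [ha]
    iterate 6 rw [sum_sq_add_single]
    simp only [Pi.add_apply, Pi.zero_apply, Pi.single_eq_same,
      Pi.single_eq_of_ne hfc.symm]
    omega
  · have h1 := chooseProd_triple (D := a + e) f
    have h2 := chooseProd_pair (D := a + e) hfc
    rw [← ha] at h2
    have af : a f = 1 := by simp [ha, hfc]
    have ac : a c = 2 := by simp [ha, hfc.symm]
    simp only [Pi.add_apply, af, ac] at h1 h2 ⊢
    obtain ⟨y, hy⟩ : ∃ y, e f = y + 2 := ⟨e f - 2, by omega⟩
    rw [hy] at h1 h2 hec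
    rw [show 1 + (y + 2) - 1 = y + 2 by omega, show 1 + (y + 2) - 2 = y + 1 by omega] at h1
    rw [show 2 + e c - 1 = 1 + e c by omega] at h2
    have h3 : (2 + e c) * (1 + e c) ≤ (y + 2) * (y + 1) :=
      Nat.mul_le_mul (by omega) (by omega)
    refine Nat.le_of_mul_le_mul_right (c := 6) ?_ (by norm_num)
    calc chooseProd (a + e) a * 6
        = 3 * (1 + (y + 2)) * ((2 + e c) * (1 + e c)) := by linear_combination 3 * h2
      _ ≤ 3 * (1 + (y + 2)) * ((y + 2) * (y + 1)) := Nat.mul_le_mul_left _ h3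
      _ ≤ 12 * ((1 + (y + 2)) * (y + 2) * (y + 1)) := by
        rw [mul_assoc, mul_assoc]; exact Nat.mul_le_mul_right _ (by norm_num)
      _ = _ := by linear_combination 12 * h1.symm

/-- The numerical alternative for three legs meeting at an interior vertex of the spine. -/
theorem hasWeakSwap_or_of_interior (hfl : f ≠ l) (hfc : f ≠ c) (hlc : l ≠ c)
    (ha : a = 0 + Pi.single f 1 + Pi.single l 1 + Pi.single c 1)
    (hf : h f = 1) (hl : h l = 1) (hc : h c = 2) (h2 : ∀ i, 2 ≤ a i + h i) :
    HasWeakSwap 12 h (a + e) a ∨ e = 0 := by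
  wlog hle : e l ≤ e f generalizing f l
  · exact this hfl.symm hlc hfc (by rw [ha]; abel) hl hf (by omega)
  have af : a f = 1 := by simp [ha, hfl, hfc]
  have al : a l = 1 := by simp [ha, hfl.symm, hlc]
  have ac : a c = 1 := by simp [ha, hfc.symm, hlc.symm]
  by_cases h1 : e f + 1 ≤ 4 * e c
  · exact Or.inl (hasWeakSwap_single hfc (by omega) (by omega) (by omega) (by rw [af, ac]; omega))
  by_cases h3 : 2 ≤ e f
  · exact Or.inl (hasWeakSwap_triple_interior hfl hfc hlc ha hf hl hc hle h3 (by omega))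
  by_cases h4 : 1 ≤ e f
  · exact Or.inl (hasWeakSwap_single hfl.symm (by omega) (by omega) h4 (by rw [af, al]; omega))
  by_cases h5 : ∃ q, 1 ≤ e q
  · obtain ⟨q, hq⟩ := h5
    have hqf : f ≠ q := by rintro rfl; exact h4 hq
    have hql : q ≠ l := by rintro rfl; omega
    have hqc : q ≠ c := by rintro rfl; omega
    have aq : a q = 0 := by simp [ha, hqf.symm, hql, hqc]
    have := h2 q
    exact Or.inl (hasWeakSwap_single hqf (by omega) (by omega) hq (by rw [aq, af]; omega))
  · push Not at h5
    exact Or.inr (funext fun i => by have := h5 i; simp only [Pi.zero_apply]; omega)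

/-- The numerical alternative for three legs meeting at an end of the spine. -/
theorem hasWeakSwap_or_of_end (hfc : f ≠ c)
    (ha : a = 0 + Pi.single f 1 + Pi.single c 1 + Pi.single c 1)
    (hf : h f = 1) (hc : h c = 1) (h2 : ∀ i, 2 ≤ a i + h i) :
    HasWeakSwap 12 h (a + e) a ∨ (e f ≤ 1 ∧ ∀ i, i ≠ f → e i = 0) := by
  have af : a f = 1 := by simp [ha, hfc]
  have ac : a c = 2 := by simp [ha, hfc.symm]
  by_cases h1 : e f + 1 ≤ 4 * e c
  · exact Or.inl (hasWeakSwap_single hfc (by omega) (by omega) (by omega) (by rw [af, ac]; omega))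
  by_cases h3 : 2 ≤ e f
  · exact Or.inl (hasWeakSwap_triple_end hfc ha hf hc h3 (by omega))
  by_cases h5 : ∃ q, q ≠ f ∧ 1 ≤ e q
  · obtain ⟨q, hqf, hq⟩ := h5
    have hqc : q ≠ c := by rintro rfl; omega
    have aq : a q = 0 := by simp [ha, hqf, hqc]
    have := h2 q
    exact Or.inl (hasWeakSwap_single hqf.symm (by omega) (by omega) hq (by rw [aq, af]; omega))
  · push Not at h5
    exact Or.inr ⟨by omega, fun i hi => by have := h5 i hi; omega⟩

end Three

section Three

variable {V W ι : Type*} {G : SimpleGraph V} {S : SimpleGraph W} {H : SimpleGraph ι}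

/-- The vertices of degree one in `X`. -/
noncomputable def leafSet (G : SimpleGraph V) (X : Finset V) : Finset V :=
  X.filter fun x => degIn G X x = 1

open scoped Classical in
/-- The leaves of `X` and their neighbours. -/
noncomputable def endCands (G : SimpleGraph V) (X : Finset V) : Finset V :=
  leafSet G X ∪ (leafSet G X).biUnion fun y => X.filter (G.Adj y)

theorem card_endCands_le (X : Finset V) : (endCands G X).card ≤ 2 * (leafSet G X).card := by
  classical
  have h : ((leafSet G X).biUnion fun y => X.filter (G.Adj y)).card ≤ (leafSet G X).card * 1 :=
    Finset.card_biUnion_le_card_mul _ _ _ fun y hy => by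
      refine le_of_eq ?_
      rw [← (Finset.mem_filter.1 hy).2, degIn]
  have := Finset.card_union_le (leafSet G X) ((leafSet G X).biUnion fun y => X.filter (G.Adj y))
  rw [endCands]
  convert this.trans (by omega : _ ≤ 2 * (leafSet G X).card)

theorem degIn_pathGraph_eq {m : ℕ} (i : Fin (m + 2)) :
    degIn (pathGraph (m + 2)) Finset.univ i = if i = 0 ∨ i = Fin.last (m + 1) then 1 else 2 := by
  have := i.2
  rw [degIn_pathGraph]
  simp only [Fin.ext_iff, Fin.val_zero, Fin.val_last]
  split_ifs <;> omega

theorem card_filter_degIn_pathGraph_le (m : ℕ) :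
    (Finset.univ.filter fun i => degIn (pathGraph (m + 2)) Finset.univ i = 1).card ≤ 2 := by
  refine (Finset.card_le_card (t := {0, Fin.last (m + 1)}) fun i hi => ?_).trans
    Finset.card_le_two
  rw [Finset.mem_filter, degIn_pathGraph_eq] at hi
  by_contra hne
  simp only [Finset.mem_insert, Finset.mem_singleton] at hne
  simp [hne] at hi

variable [Fintype V] [Fintype ι]

theorem IsSkel.mem_endCands {p : ι → V} (hp : IsSkel G H p) (hG : G.IsAcyclic)
    (hH : H.Preconnected) {b : ι → ℕ} {X : Finset V} (hX : X ∈ leafFamily G p b) {i : ι}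
    (hi : degIn H Finset.univ i = 1) : p i ∈ endCands G X := by
  classical
  have hX' := mem_leafFamily.1 hX
  have hd := hp.degIn_skel hG hH hX i
  rw [hi] at hd
  rw [endCands, Finset.mem_union]
  rcases Nat.eq_zero_or_pos (b i) with h0 | h0
  · left
    rw [leafSet, Finset.mem_filter]
    exact ⟨hX'.1 i, by rw [hd, h0]⟩
  · right
    obtain ⟨x, hx⟩ := Finset.card_pos.1 (h0.trans_eq (hX'.2.2 i).symm)
    rw [Finset.mem_inter] at hx
    rw [Finset.mem_biUnion]
    refine ⟨x, ?_, ?_⟩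
    · rw [leafSet, Finset.mem_filter]
      exact ⟨hx.1, hp.degIn_off hG hH hX hx.2⟩
    · rw [Finset.mem_filter]
      exact ⟨hX'.1 i, (mem_offNbrs.1 hx.2).1.symm⟩

theorem IsSkel.card_leafSet {p : ι → V} (hp : IsSkel G H p) (hG : G.IsAcyclic)
    (hH : H.Preconnected) {b : ι → ℕ} {X : Finset V} (hX : X ∈ leafFamily G p b) :
    (leafSet G X).card
      = (Finset.univ.filter fun i => b i + degIn H Finset.univ i = 1).card + ∑ i, b i := by
  have := hp.sum_degIn hG hH hX fun d => if d = 1 then 1 else 0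
  rw [leafSet, Finset.card_filter, Finset.card_filter, this]
  simp

open scoped Classical in
/-- The path skeletons whose ends lie near leaves of `X`, provided that `X` has few leaves. -/
noncomputable def endSkels (G : SimpleGraph V) (s : ℕ) (X : Finset V) : Finset (Fin s → V) :=
  Finset.univ.filter fun p => IsSkel G (pathGraph s) p ∧ (leafSet G X).card ≤ 5 ∧
    ∀ i, degIn (pathGraph s) Finset.univ i = 1 → p i ∈ endCands G X

theorem card_endSkels_le (hG : G.IsAcyclic) (m : ℕ) (X : Finset V) :
    (endSkels G (m + 2) X).card ≤ 100 := by
  classical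
  rcases (endSkels G (m + 2) X).eq_empty_or_nonempty with h | ⟨p₀, hp₀⟩
  · simp [h]
  simp only [endSkels, Finset.mem_filter, Finset.mem_univ, true_and] at hp₀
  have hE : (endCands G X).card ≤ 10 := (card_endCands_le X).trans (by omega)
  have h1 : (endSkels G (m + 2) X).card ≤ (endCands G X ×ˢ endCands G X).card := by
    refine Finset.card_le_card_of_injOn (fun p => (p 0, p (Fin.last (m + 1)))) ?_ ?_
    · intro p hp
      simp only [endSkels, Finset.coe_filter, Finset.mem_univ, true_and, Set.mem_ofPred_eq] at hp
      simp only [Finset.coe_product, Set.mem_prod, Finset.mem_coe]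
      exact ⟨hp.2.2 _ (by simp [degIn_pathGraph_eq]), hp.2.2 _ (by simp [degIn_pathGraph_eq])⟩
    · intro p hp p' hp' h
      simp only [endSkels, Finset.coe_filter, Finset.mem_univ, true_and,
        Set.mem_ofPred_eq] at hp hp'
      simp only [Prod.mk.injEq] at h
      exact hp.1.path_unique hG hp'.1 h.1 h.2
  rw [Finset.card_product] at h1
  exact h1.trans (Nat.mul_le_mul hE hE)

variable [Fintype W]

theorem HasSpine.charge_of_hasWeakSwap {m K : ℕ} {a : Fin (m + 2) → ℕ} (hS : S.IsTree)
    (h : HasSpine S (m + 2) a) (hG : G.IsAcyclic) (ha3 : ∑ i, a i = 3) {p : Fin (m + 2) → V}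
    (hp : IsSkel G (pathGraph (m + 2)) p)
    (hsw : HasWeakSwap K (degIn (pathGraph (m + 2)) Finset.univ) (offDeg G p) a) :
    ∃ Y ⊆ others G S, (leafFamily G p a).card ≤ K * Y.card ∧
      ∀ X ∈ Y, p ∈ endSkels G (m + 2) X := by
  obtain ⟨a', h1, h2, h4⟩ := hsw
  have hH := pathGraph_connected (m + 1)
  refine ⟨leafFamily G p a', ?_, ?_, fun X hX => ?_⟩
  · refine h.family_subset_others hS hG hH hp (by rw [h1]; simp) (fun d => d ^ 2) ?_
    rw [h1]
    simpa using h2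
  · rwa [hp.card_leafFamily hG hH.preconnected, hp.card_leafFamily hG hH.preconnected]
  · simp only [endSkels, Finset.mem_filter, Finset.mem_univ, true_and]
    refine ⟨hp, ?_, fun i hi => hp.mem_endCands hG hH.preconnected hX hi⟩
    rw [hp.card_leafSet hG hH.preconnected hX, h1, ha3]
    refine Nat.add_le_add_right (le_trans (Finset.card_le_card fun i hi => ?_)
      (card_filter_degIn_pathGraph_le m)) 3
    rw [Finset.mem_filter] at hi ⊢
    have := degIn_pathGraph_pos (by omega : 2 ≤ m + 2) i
    exact ⟨hi.1, by omega⟩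

/-- If the leg with a single edge can be prolonged, then one of the other two legs can be
shortened. -/
theorem HasSpine.charge_of_center {m : ℕ} {a : Fin (m + 2) → ℕ} {c z z' : Fin (m + 2)}
    (hS : S.IsTree) (h : HasSpine S (m + 2) a) (hG : G.IsAcyclic)
    (hz : z ≠ z') (hzc : z ≠ c) (hzc' : z' ≠ c) (hadj : ¬ (pathGraph (m + 2)).Adj c z)
    (ha : a = 0 + Pi.single z 1 + Pi.single z' 1 + Pi.single c 1)
    (hends : ∀ i, degIn (pathGraph (m + 2)) Finset.univ i = 1 ↔ i = z ∨ i = z')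
    {p : Fin (m + 2) → V} (hp : IsSkel G (pathGraph (m + 2)) p) (he : offDeg G p = a)
    {u : V} (hu : u ∈ offNbrs G p c) (hu' : 1 ≤ offDeg G (extendBy p u) none) :
    ∃ Y ⊆ others G S, (leafFamily G p a).card ≤ Y.card ∧ ∀ X ∈ Y, p ∈ endSkels G (m + 2) X := by
  classical
  have hH := pathGraph_connected (m + 1)
  have hH' : (pendant (pathGraph (m + 2)) c).Connected :=
    ⟨pendant_preconnected hH.preconnected c⟩
  have hu1 := mem_offNbrs.1 hu
  have hpu := hp.extend hu1.1 hu1.2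
  have hle := degIn_pathGraph_le (s := m + 2)
  have hpos := degIn_pathGraph_pos (by omega : 2 ≤ m + 2)
  have hc2 : degIn (pathGraph (m + 2)) Finset.univ c = 2 := by
    have h1 := hpos c
    have h2 := hle c
    have h3 : degIn (pathGraph (m + 2)) Finset.univ c ≠ 1 := fun h3 => by
      rcases (hends c).1 h3 with h4 | h4
      · exact hzc h4.symm
      · exact hzc' h4.symm
    omega
  set b : Fin (m + 2) → ℕ := Pi.single z' 1 with hb
  have hsum : ∑ o, extendBy b 1 o = 2 := by
    rw [Fintype.sum_option]
    change 1 + ∑ i, b i = 2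
    rw [hb]; simp
  refine ⟨leafFamily G (extendBy p u) (extendBy b 1), fun X hX => ?_, ?_, fun X hX => ?_⟩
  · refine h.mem_others hS hG hH' hpu hX ?_ fun φ => ?_
    · rw [hsum, ha, sum_add_single, sum_add_single, sum_add_single]
      simp
    have hX' := mem_leafFamily.1 hX
    obtain ⟨q, hq, hqu, -⟩ := h
    have hw := hq.degIn_skel hS.isAcyclic hH.preconnected hqu c
    have hqu' := mem_leafFamily.1 hqu
    have hac : a c = 1 := by rw [ha]; simp [hb, hzc.symm, hzc'.symm]
    obtain ⟨w, hw'⟩ : (Finset.univ ∩ offNbrs S q c).Nonempty := by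
      rw [← Finset.card_pos, hqu'.2.2 c, hac]; exact one_pos
    rw [Finset.univ_inter] at hw'
    have hw1 := hq.degIn_off hS.isAcyclic hH.preconnected hqu hw'
    have hww := (mem_offNbrs.1 hw').1
    have hx := degIn_eq_of_iso φ (φ.symm (q c))
    have hx1 := degIn_eq_of_iso φ (φ.symm w)
    have hxx : G.Adj (φ.symm (q c)) (φ.symm w) := φ.symm.map_rel_iff.2 hww
    rw [RelIso.apply_symm_apply] at hx hx1
    rw [hw, hc2, hac] at hx
    rw [hw1] at hx1
    have hxX := (φ.symm (q c)).2
    have hwX := (φ.symm w).2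
    generalize (φ.symm (q c) : V) = x at *
    generalize (φ.symm w : V) = y at *
    have hxc : x = p c := by
      rcases hX'.2.1 x hxX with ⟨o, rfl⟩ | ⟨o, ho⟩
      · rw [hpu.degIn_skel hG hH'.preconnected hX] at hx
        rcases o with _ | i
        · rw [degIn_pendant_none] at hx
          exact absurd hx (by norm_num [extendBy])
        · rw [degIn_pendant_some] at hx
          change _ + b i = 3 at hx
          by_cases hic : i = c
          · rw [hic]; rfl
          · have h1 := hle i
            have h2 := (hends i).2
            rw [Pi.single_eq_of_ne hic, hb] at hx
            by_cases hiz : i = z'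
            · rw [h2 (Or.inr hiz), hiz, Pi.single_eq_same] at hx
              omega
            · rw [Pi.single_eq_of_ne hiz] at hx
              omega
      · rw [hpu.degIn_off hG hH'.preconnected hX ho] at hx
        omega
    subst hxc
    rcases hX'.2.1 y hwX with ⟨o, rfl⟩ | ⟨o, ho⟩
    · rw [hpu.degIn_skel hG hH'.preconnected hX] at hx1
      rcases o with _ | i
      · rw [degIn_pendant_none] at hx1
        exact absurd hx1 (by norm_num [extendBy])
      · rw [degIn_pendant_some] at hx1
        change _ + b i = 1 at hx1
        have h1 := hpos i
        have hci : (pathGraph (m + 2)).Adj c i := (hp.adj_iff hG hH.preconnected).1 hxx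
        rcases (hends i).1 (by omega) with rfl | rfl
        · exact hadj hci
        · rw [hb, Pi.single_eq_same] at hx1
          omega
    · have h1 := mem_offNbrs.1 ho
      have h2 : o = some c := hpu.eq_of_adj_off hG hH'.preconnected h1.2 h1.1 hxx
      subst h2
      have h3 := hX'.2.2 (some c)
      change _ = b c at h3
      rw [hb, Pi.single_eq_of_ne hzc'.symm, Finset.card_eq_zero] at h3
      exact Finset.notMem_empty y (h3 ▸ Finset.mem_inter.2 ⟨hwX, ho⟩)
  · rw [hp.card_leafFamily hG hH.preconnected, hpu.card_leafFamily hG hH'.preconnected,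
      chooseProd_extendBy hp hG hH.preconnected hu, Nat.choose_one_right, he]
    have h1 : chooseProd a a = 1 := by simp [chooseProd]
    rw [h1]
    refine Nat.mul_pos hu' (chooseProd_pos fun i => ?_)
    rw [ha, hb]
    simp only [Pi.add_apply, Pi.sub_apply, Pi.zero_apply]
    omega
  · simp only [endSkels, Finset.mem_filter, Finset.mem_univ, true_and]
    refine ⟨hp, ?_, fun i hi => ?_⟩
    · rw [hpu.card_leafSet hG hH'.preconnected hX, hsum]
      refine le_trans (Nat.add_le_add_right (le_trans (Finset.card_le_card
        (t := (Finset.univ.filter fun i => degIn (pathGraph (m + 2)) Finset.univ i = 1).map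
          Function.Embedding.some) fun o ho => ?_)
        ((Finset.card_map _).trans_le (card_filter_degIn_pathGraph_le m))) 2) (by norm_num)
      rw [Finset.mem_filter] at ho
      rcases o with _ | i
      · rw [degIn_pendant_none] at ho
        exact absurd ho.2 (by norm_num [extendBy])
      · rw [degIn_pendant_some] at ho
        rw [Finset.mem_map]
        have := hpos i
        exact ⟨i, Finset.mem_filter.2 ⟨Finset.mem_univ i, by omega⟩, rfl⟩
    · refine hpu.mem_endCands hG hH'.preconnected hX (i := some i) ?_
      have hic : i ≠ c := by rintro rfl; omega
      rw [degIn_pendant_some, hi, Pi.single_eq_of_ne hic, add_zero]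

end Three

section Three

variable {V W : Type*} {G : SimpleGraph V} {S : SimpleGraph W} [Fintype V] [Fintype W]

theorem HasSpine.exists_child_of_card {m : ℕ} {a e : Fin (m + 2) → ℕ} (hS : S.IsTree)
    (h : HasSpine S (m + 2) a) (hG : G.IsTree) (hV : 8 * Fintype.card W < Fintype.card V)
    {p : Fin (m + 2) → V} (he : offDeg G p = a + e) (hsum : ∑ i, e i ≤ m + 2) :
    ∃ t, 1 ≤ a t + e t ∧ ∃ u ∈ offNbrs G p t, 1 ≤ offDeg G (extendBy p u) none := by
  obtain ⟨t, u, hu, hu'⟩ := exists_child (p := p) hG.connected (by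
    have hc := h.card hS
    rw [he, Fintype.card_fin]
    simp only [Pi.add_apply, Finset.sum_add_distrib]
    omega)
  refine ⟨t, ?_, u, hu, hu'⟩
  have : 0 < offDeg G p t := Finset.card_pos.2 ⟨u, hu⟩
  rwa [he] at this

theorem HasSpine.charge_of_three_interior {m : ℕ} {a e : Fin (m + 2) → ℕ} (hm : 2 ≤ m)
    (hS : S.IsTree) (h : HasSpine S (m + 2) a) (hG : G.IsTree)
    (hV : 8 * Fintype.card W < Fintype.card V) {c : Fin (m + 2)} (hc0 : c ≠ 0)
    (hcl : c ≠ Fin.last (m + 1))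
    (ha : a = 0 + Pi.single 0 1 + Pi.single (Fin.last (m + 1)) 1 + Pi.single c 1)
    {p : Fin (m + 2) → V} (hp : IsSkel G (pathGraph (m + 2)) p) (he : offDeg G p = a + e) :
    ∃ Y ⊆ others G S, (leafFamily G p a).card ≤ 12 * Y.card ∧
      ∀ X ∈ Y, p ∈ chargers G (m + 2) X ∨ p ∈ endSkels G (m + 2) X := by
  classical
  have h0l : (0 : Fin (m + 2)) ≠ Fin.last (m + 1) := Fin.last_pos.ne
  have hd0 : degIn (pathGraph (m + 2)) Finset.univ 0 = 1 := by simp [degIn_pathGraph_eq]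
  have hdl : degIn (pathGraph (m + 2)) Finset.univ (Fin.last (m + 1)) = 1 := by
    simp [degIn_pathGraph_eq]
  have hdc : degIn (pathGraph (m + 2)) Finset.univ c = 2 := by simp [degIn_pathGraph_eq, hc0, hcl]
  have h2 := h.choose_spec.2.2
  have ha0 : a 0 = 1 := by rw [ha]; simp [hc0.symm]
  have hal : a (Fin.last (m + 1)) = 1 := by rw [ha]; simp [hcl.symm]
  have hac : a c = 1 := by rw [ha]; simp [hc0, hcl]
  have ha3 : ∑ i, a i = 3 := by
    rw [ha, sum_add_single, sum_add_single, sum_add_single]; simp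
  rcases hasWeakSwap_or_of_interior h0l hc0.symm hcl.symm ha hd0 hdl hdc h2 (e := e)
    with hsw | rfl
  · obtain ⟨Y, h1, h3, h4⟩ := h.charge_of_hasWeakSwap hS hG.isAcyclic ha3 hp (he ▸ hsw)
    exact ⟨Y, h1, h3, fun X hX => Or.inr (h4 X hX)⟩
  obtain ⟨t, ht, u, hu, hu'⟩ := h.exists_child_of_card hS hG hV he (by simp)
  by_cases htc : t = c
  · subst htc
    have hends : ∀ i, degIn (pathGraph (m + 2)) Finset.univ i = 1
        ↔ i = 0 ∨ i = Fin.last (m + 1) := fun i => by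
      rw [degIn_pathGraph_eq]
      by_cases hi : i = 0 ∨ i = Fin.last (m + 1) <;> simp [hi]
    rw [add_zero] at he
    have key : ∃ Y ⊆ others G S, (leafFamily G p a).card ≤ Y.card ∧
        ∀ X ∈ Y, p ∈ endSkels G (m + 2) X := by
      by_cases hadj : (pathGraph (m + 2)).Adj t 0
      · refine h.charge_of_center hS hG.isAcyclic h0l.symm hcl.symm hc0.symm ?_ ?_ ?_ hp he hu hu'
        · rw [pathGraph_adj] at hadj ⊢
          simp only [Fin.val_zero, Fin.val_last] at hadj ⊢
          omega
        · rw [ha]; abel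
        · exact fun i => (hends i).trans or_comm
      · exact h.charge_of_center hS hG.isAcyclic h0l hc0.symm hcl.symm hadj ha hends hp he hu hu'
    obtain ⟨Y, h1, h3, h4⟩ := key
    exact ⟨Y, h1, by omega, fun X hX => Or.inr (h4 X hX)⟩
  · have hat : 1 ≤ a t := by simpa using ht
    obtain ⟨Y, h1, h3, h4⟩ := h.charge_of_hasStretch (K := 12) hS (by omega) hG.isAcyclic hp hu hu'
      (he ▸ hasStretch_ne h2 (Ne.symm htc) (by omega) (by omega) hat (by
        rw [hac]
        simp only [Pi.zero_apply]
        omega))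
    exact ⟨Y, h1, h3, fun X hX => Or.inl (h4 X hX)⟩

theorem HasSpine.charge_of_three_end {m : ℕ} {a e : Fin (m + 2) → ℕ}
    (hS : S.IsTree) (h : HasSpine S (m + 2) a) (hG : G.IsTree)
    (hV : 8 * Fintype.card W < Fintype.card V) {c f : Fin (m + 2)} (hfc : f ≠ c)
    (hf : degIn (pathGraph (m + 2)) Finset.univ f = 1)
    (hc : degIn (pathGraph (m + 2)) Finset.univ c = 1)
    (ha : a = 0 + Pi.single f 1 + Pi.single c 1 + Pi.single c 1)
    {p : Fin (m + 2) → V} (hp : IsSkel G (pathGraph (m + 2)) p) (he : offDeg G p = a + e) :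
    ∃ Y ⊆ others G S, (leafFamily G p a).card ≤ 12 * Y.card ∧
      ∀ X ∈ Y, p ∈ chargers G (m + 2) X ∨ p ∈ endSkels G (m + 2) X := by
  classical
  have h2 := h.choose_spec.2.2
  have haf : a f = 1 := by rw [ha]; simp [hfc]
  have hac : a c = 2 := by rw [ha]; simp [hfc.symm]
  have ha3 : ∑ i, a i = 3 := by
    rw [ha, sum_add_single, sum_add_single, sum_add_single]; simp
  rcases hasWeakSwap_or_of_end hfc ha hf hc h2 (e := e) with hsw | ⟨hef, hei⟩
  · obtain ⟨Y, h1, h3, h4⟩ := h.charge_of_hasWeakSwap hS hG.isAcyclic ha3 hp (he ▸ hsw)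
    exact ⟨Y, h1, h3, fun X hX => Or.inr (h4 X hX)⟩
  obtain ⟨t, ht, u, hu, hu'⟩ := h.exists_child_of_card hS hG hV he (by
    rw [Finset.sum_eq_single f (fun i _ hi => hei i hi) (by simp)]
    omega)
  have hst : HasStretch 12 (degIn (pathGraph (m + 2)) Finset.univ) (a + e) a t := by
    by_cases htc : t = c
    · subst htc
      refine hasStretch_same h2 (by omega) ?_
      rw [hac, hei t hfc.symm]
      omega
    · have hat : a t = 1 ∧ e t ≤ 1 := by
        by_cases htf : t = f
        · rw [htf]; exact ⟨haf, hef⟩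
        · have h0 := hei t htf
          have : a t = 0 := by rw [ha]; simp [htc, htf]
          omega
      refine hasStretch_ne h2 (Ne.symm htc) (by omega) (by omega) hat.1.ge ?_
      rw [hac, hat.1, hei c hfc.symm]
      omega
  obtain ⟨Y, h1, h3, h4⟩ := h.charge_of_hasStretch (K := 12) hS (by omega) hG.isAcyclic hp hu hu'
    (he ▸ hst)
  exact ⟨Y, h1, h3, fun X hX => Or.inl (h4 X hX)⟩

theorem HasSpine.card_copies_of_three {s : ℕ} {a : Fin s → ℕ} (hS : S.IsTree) (hs : 4 ≤ s)
    (h : HasSpine S s a) (hG : G.IsTree) (hV : 8 * Fintype.card W < Fintype.card V)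
    {c : Fin s} (ha : ∀ i, i ≠ c → a i + degIn (pathGraph s) Finset.univ i = 2)
    (hc : a c + degIn (pathGraph s) Finset.univ c = 3) :
    (copies G S).card ≤ 1296 * (others G S).card := by
  classical
  obtain ⟨m, rfl⟩ : ∃ m, s = m + 2 := ⟨s - 2, by omega⟩
  have h0l : (0 : Fin (m + 2)) ≠ Fin.last (m + 1) := Fin.last_pos.ne
  refine h.card_copies_le.trans
    (sum_le_of_charge (K := 12) (M := 108) _ _
      (fun X => chargers G (m + 2) X ∪ endSkels G (m + 2) X)
      _ (fun X _ => (Finset.card_union_le _ _).trans (Nat.add_le_add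
        (card_chargers_le hG.isAcyclic (m + 1) X) (card_endSkels_le hG.isAcyclic m X)))
      fun p hp => ?_)
  rw [mem_allSkels] at hp
  simp only [Finset.mem_union]
  rcases hp.charge_or (a := a) hG.isAcyclic with h00 | ⟨e, he⟩
  · exact ⟨∅, Finset.empty_subset _, by simp [h00], by simp⟩
  have hval : ∀ i, i ≠ c → a i = if i = 0 ∨ i = Fin.last (m + 1) then 1 else 0 := fun i hi => by
    have := ha i hi
    rw [degIn_pathGraph_eq] at this
    split_ifs at this ⊢ <;> omega
  rw [degIn_pathGraph_eq] at hc
  by_cases hc0 : c = 0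
  · subst hc0
    refine h.charge_of_three_end hS hG hV h0l.symm (by simp [degIn_pathGraph_eq])
      (by simp [degIn_pathGraph_eq]) ?_ hp he
    funext i
    by_cases hi : i = 0
    · subst hi
      simp [h0l] at hc ⊢
      omega
    · rw [hval i hi]
      by_cases hil : i = Fin.last (m + 1) <;> simp [hi, hil]
  by_cases hcl : c = Fin.last (m + 1)
  · subst hcl
    refine h.charge_of_three_end hS hG hV h0l (by simp [degIn_pathGraph_eq])
      (by simp [degIn_pathGraph_eq]) ?_ hp he
    funext i
    by_cases hi : i = Fin.last (m + 1)
    · subst hi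
      simp [h0l.symm] at hc ⊢
      omega
    · rw [hval i hi]
      by_cases hil : i = 0
      · subst hil; simp [h0l]
      · simp [hi, hil]
  · refine h.charge_of_three_interior (by omega) hS hG hV hc0 hcl ?_ hp he
    funext i
    by_cases hi : i = c
    · subst hi
      simp [hc0, hcl] at hc ⊢
      omega
    · rw [hval i hi]
      by_cases hi0 : i = 0
      · subst hi0; simp [h0l, hi]
      · by_cases hil : i = Fin.last (m + 1)
        · subst hil; simp [h0l.symm, hi]
        · simp [hi, hi0, hil]

end Three

section Spine

variable {W : Type*} [Fintype W] {S : SimpleGraph W}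

theorem ndeg_eq_degIn (v : W) : ndeg S v = degIn S Finset.univ v := by
  classical
  have : S.neighborSet v = (Finset.univ.filter (S.Adj v) : Finset W) := by
    ext x; simp
  rw [ndeg, this, Set.ncard_coe_finset, degIn]

theorem one_lt_degIn_iff {v : W} :
    2 ≤ degIn S Finset.univ v ↔ ∃ x y, S.Adj v x ∧ S.Adj v y ∧ x ≠ y := by
  classical
  rw [degIn, Nat.succ_le_iff, Finset.one_lt_card]
  simp only [Finset.mem_filter, Finset.mem_univ, true_and]
  exact ⟨fun ⟨x, hx, y, hy, h⟩ => ⟨x, y, hx, hy, h⟩, fun ⟨x, y, hx, hy, h⟩ => ⟨x, hx, y, hy, h⟩⟩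

theorem nontrivialBranch_of_two_le {v u : W} (h : S.Adj v u) (hu : 2 ≤ degIn S Finset.univ u) :
    NontrivialBranch S v u := by
  refine ⟨h, fun hb => ?_⟩
  obtain ⟨x, y, hx, hy, hxy⟩ := one_lt_degIn_iff.1 hu
  have key : ∀ w, S.Adj u w → w = v := fun w hw => by
    by_contra hwv
    have h1 : w ∈ branchSet S v u := ⟨hw.toWalk, by simp [h.ne, Ne.symm hwv]⟩
    rw [hb] at h1
    exact hw.ne h1.symm
  exact hxy ((key x hx).trans (key y hy).symm)

/-- In a caterpillar no vertex has three neighbours that are not leaves. -/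
theorem IsCaterpillar.not_three (hcat : IsCaterpillar S) {v x y z : W}
    (hx : S.Adj v x) (hy : S.Adj v y) (hz : S.Adj v z) (hx2 : 2 ≤ degIn S Finset.univ x)
    (hy2 : 2 ≤ degIn S Finset.univ y) (hz2 : 2 ≤ degIn S Finset.univ z)
    (hxy : x ≠ y) (hxz : x ≠ z) (hyz : y ≠ z) : False := by
  classical
  have h1 : ({x, y, z} : Finset W).card = 3 := Finset.card_eq_three.2 ⟨x, y, z, hxy, hxz, hyz, rfl⟩
  have h2 : (({x, y, z} : Finset W) : Set W) ⊆ {u | NontrivialBranch S v u} := by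
    intro u hu
    simp only [Finset.coe_insert, Finset.coe_singleton, Set.mem_insert_iff,
      Set.mem_singleton_iff] at hu
    rcases hu with rfl | rfl | rfl
    · exact nontrivialBranch_of_two_le hx hx2
    · exact nontrivialBranch_of_two_le hy hy2
    · exact nontrivialBranch_of_two_le hz hz2
  have h3 := Set.ncard_le_ncard h2 (Set.toFinite _)
  rw [Set.ncard_coe_finset, h1] at h3
  have := hcat.2 v
  omega

theorem IsSkel.cons {V : Type*} {G : SimpleGraph V} {m : ℕ} {q : Fin (m + 1) → V} {y : V}
    (hq : IsSkel G (pathGraph (m + 1)) q) (hy : y ∉ Set.range q) (hadj : G.Adj (q 0) y) :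
    IsSkel G (pathGraph (m + 2)) (Fin.cons y q : Fin (m + 2) → V) where
  inj := Fin.cons_injective_iff.2 ⟨hy, hq.inj⟩
  adj := by
    intro i j
    refine Fin.cases ?_ (fun i => ?_) i <;> refine Fin.cases ?_ (fun j => ?_) j
    · intro h; exact absurd rfl h.ne
    · intro h
      rw [pathGraph_adj] at h
      have : j = 0 := by ext; simpa using h
      subst this
      simpa using hadj.symm
    · intro h
      rw [pathGraph_adj] at h
      have : i = 0 := by ext; simpa using h
      subst this
      simpa using hadj
    · intro h
      rw [pathGraph_adj] at h
      simp only [Fin.cons_succ]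
      refine hq.adj i j (pathGraph_adj.2 ?_)
      simpa using h

theorem IsSkel.rev {V : Type*} {G : SimpleGraph V} {s : ℕ} {q : Fin s → V}
    (hq : IsSkel G (pathGraph s) q) : IsSkel G (pathGraph s) (q ∘ Fin.rev) where
  inj := hq.inj.comp Fin.rev_injective
  adj := fun i j h => by
    refine hq.adj _ _ ?_
    rw [pathGraph_adj] at *
    simp only [Fin.val_rev]
    omega

/-- If the inner vertices of a tree do not all lie on the skeleton, then one of them is adjacent
to it. -/
theorem exists_adj_inner (hS : S.Connected) {ι : Type*} [Nonempty ι] {q : ι → W}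
    (hne : ∃ x, x ∉ Set.range q ∧ ∀ i, S.Adj (q i) x → 2 ≤ degIn S Finset.univ x) :
    ∃ i y, S.Adj (q i) y ∧ y ∉ Set.range q ∧ 2 ≤ degIn S Finset.univ y := by
  obtain ⟨x, hx, hx2⟩ := hne
  by_contra! hcon
  obtain ⟨i₀⟩ := (inferInstance : Nonempty ι)
  obtain ⟨w⟩ := hS.preconnected (q i₀) x
  set R : Set W := {v | v ∈ Set.range q ∨ ∃ i, S.Adj (q i) v} with hR
  have hxR : x ∉ R := by
    rintro (h | ⟨i, hi⟩)
    · exact hx h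
    · exact absurd (hx2 i hi) (not_le.2 (hcon i x hi hx))
  obtain ⟨d, -, h1, h2⟩ := w.exists_boundary_dart R (Or.inl ⟨i₀, rfl⟩) hxR
  have hd := d.adj
  simp only [hR, Set.mem_ofPred_eq, not_or, not_exists] at h1 h2
  rcases h1 with ⟨i, hi⟩ | ⟨i, hi⟩
  · exact h2.2 i (hi ▸ hd)
  · by_cases hr : d.fst ∈ Set.range q
    · obtain ⟨j, hj⟩ := hr
      exact h2.2 j (hj ▸ hd)
    · refine absurd (hcon i _ hi hr) (not_lt.2 (one_lt_degIn_iff.2 ⟨q i, d.snd, hi.symm, hd, ?_⟩))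
      intro h
      exact h2.1 ⟨i, h⟩

theorem IsCaterpillar.exists_spine (hcat : IsCaterpillar S)
    (hI : ∃ x y, x ≠ y ∧ 2 ≤ degIn S Finset.univ x ∧ 2 ≤ degIn S Finset.univ y) :
    ∃ s a, 2 ≤ s ∧ HasSpine S s a := by
  classical
  obtain ⟨x, y, hxy, hx, hy⟩ := hI
  have hS := hcat.1
  set P : ℕ → Prop := fun m => ∃ q : Fin (m + 1) → W, IsSkel S (pathGraph (m + 1)) q ∧
    ∀ i, 2 ≤ degIn S Finset.univ (q i) with hP
  have hP0 : P 0 := ⟨fun _ => x, ⟨fun i j _ => Subsingleton.elim (α := Fin 1) i j,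
    fun i j h => absurd (Subsingleton.elim (α := Fin 1) i j) h.ne⟩, fun _ => hx⟩
  have hPle : ∀ m, P m → m ≤ Fintype.card W := by
    rintro m ⟨q, hq, -⟩
    have := Fintype.card_le_of_injective q hq.inj
    rw [Fintype.card_fin] at this
    omega
  set m := Nat.findGreatest P (Fintype.card W) with hm
  obtain ⟨q, hq, hq2⟩ : P m := Nat.findGreatest_spec (Nat.zero_le _) hP0
  have hnot : ¬ P (m + 1) := fun h => by
    have := Nat.le_findGreatest (hPle _ h) h
    omega
  have hno : ¬ ∃ i y, S.Adj (q i) y ∧ y ∉ Set.range q ∧ 2 ≤ degIn S Finset.univ y := by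
    rintro ⟨i, y, hadj, hyr, hy2⟩
    by_cases hi0 : i = 0
    · subst hi0
      exact hnot ⟨_, hq.cons hyr hadj, Fin.cases hy2 hq2⟩
    by_cases hil : i = Fin.last m
    · subst hil
      refine hnot ⟨_, hq.rev.cons (y := y) ?_ ?_, Fin.cases hy2 fun i => hq2 _⟩
      · rwa [Fin.rev_surjective.range_comp q]
      · simpa using hadj
    · have h0 : i.1 ≠ 0 := fun h => hi0 (Fin.ext h)
      have hl : i.1 ≠ m := fun h => hil (Fin.ext h)
      have h1 := hq.adj i ⟨i.1 - 1, by omega⟩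
        (pathGraph_adj.2 (Or.inr (Nat.sub_add_cancel (Nat.pos_of_ne_zero h0))))
      have h2 := hq.adj i ⟨i.1 + 1, by omega⟩ (pathGraph_adj.2 (Or.inl rfl))
      refine hcat.not_three h1 h2 hadj (hq2 _) (hq2 _) hy2 (fun h => ?_) ?_ ?_
      · have := congrArg Fin.val (hq.inj h)
        simp only at this
        omega
      · exact fun h => hyr ⟨_, h⟩
      · exact fun h => hyr ⟨_, h⟩
  have hcov : ∀ x, x ∉ Set.range q → ∃ i, S.Adj (q i) x := by
    intro x hx
    by_contra hcon
    push Not at hcon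
    exact hno (exists_adj_inner hS.connected ⟨x, hx, fun i hi => absurd hi (hcon i)⟩)
  have hin : ∀ x, 2 ≤ degIn S Finset.univ x → x ∈ Set.range q := by
    intro x hx
    by_contra hxr
    exact hno (exists_adj_inner hS.connected ⟨x, hxr, fun _ _ => hx⟩)
  have hfam : Finset.univ ∈ leafFamily S q (offDeg S q) := by
    rw [mem_leafFamily]
    refine ⟨fun i => Finset.mem_univ _, fun x _ => ?_, fun i => by rw [Finset.univ_inter]; rfl⟩
    by_cases hx : x ∈ Set.range q
    · exact Or.inl hx
    · obtain ⟨i, hi⟩ := hcov x hx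
      exact Or.inr ⟨i, mem_offNbrs.2 ⟨hi, hx⟩⟩
  refine ⟨m + 1, offDeg S q, ?_, q, hq, hfam, fun i => ?_⟩
  · by_contra hm1
    have hm0 : m = 0 := by omega
    obtain ⟨i, hi⟩ := hin x hx
    obtain ⟨j, hj⟩ := hin y hy
    refine hxy ?_
    rw [← hi, ← hj]
    congr 1
    ext
    omega
  · have := hq.degIn_skel hS.isAcyclic (pathGraph_preconnected _) hfam i
    have := hq2 i
    omega

theorem IsCaterpillar.exists_spine_of_not (hcat : IsCaterpillar S) (h2 : 2 ≤ Fintype.card W)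
    (hstar : ¬ IsStarlike S) (hpath : ¬ IsPathlike S) :
    ∃ s a, 2 ≤ s ∧ HasSpine S s a ∧ ∃ c, 3 ≤ a c + degIn (pathGraph s) Finset.univ c := by
  have hS := hcat.1
  have : Nontrivial W := Fintype.one_lt_card_iff_nontrivial.1 h2
  have hI : ∀ v, ndeg S v ≠ 1 → 2 ≤ degIn S Finset.univ v := fun v hv => by
    classical
    rw [ndeg_eq_degIn] at hv
    obtain ⟨w, hw⟩ := hS.connected.preconnected.exists_adj_of_nontrivial v
    have : 0 < degIn S Finset.univ v := by
      rw [degIn, Finset.card_pos]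
      exact ⟨w, by simpa using hw⟩
    omega
  obtain ⟨s, a, hs, hsp⟩ := hcat.exists_spine (by
    simp only [IsStarlike, Set.not_subsingleton_iff] at hstar
    obtain ⟨x, hx, y, hy, hxy⟩ := hstar
    exact ⟨x, y, hxy, hI x hx, hI y hy⟩)
  refine ⟨s, a, hs, hsp, ?_⟩
  classical
  simp only [IsPathlike, not_forall, not_le] at hpath
  obtain ⟨v, hv⟩ := hpath
  rw [ndeg_eq_degIn] at hv
  obtain ⟨q, hq, hu, -⟩ := hsp
  have hpre := pathGraph_preconnected s
  rcases (mem_leafFamily.1 hu).2.1 v (Finset.mem_univ v) with ⟨i, rfl⟩ | ⟨i, hi⟩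
  · rw [hq.degIn_skel hS.isAcyclic hpre hu] at hv
    exact ⟨i, by omega⟩
  · rw [hq.degIn_off hS.isAcyclic hpre hu hi] at hv
    omega

variable {V : Type*} [Fintype V] {G : SimpleGraph V}

theorem IsCaterpillar.card_copies_le (hcat : IsCaterpillar S) (h17 : 17 ≤ Fintype.card W)
    (hstar : ¬ IsStarlike S) (hpath : ¬ IsPathlike S) (hG : G.IsTree)
    (hV : 8 * Fintype.card W < Fintype.card V) :
    (copies G S).card ≤ 9999 * (others G S).card := by
  obtain ⟨s, a, hs, hsp, c, hc⟩ := hcat.exists_spine_of_not (by omega) hstar hpath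
  have hS := hcat.1
  have h2 := hsp.choose_spec.2.2
  by_cases htwo : ∃ c', c ≠ c' ∧ 3 ≤ a c' + degIn (pathGraph s) Finset.univ c'
  · obtain ⟨c', hcc, hc'⟩ := htwo
    exact (hsp.card_copies_of_two hS hs hG hV hcc hc hc').trans
      (Nat.mul_le_mul_right _ (by norm_num))
  push Not at htwo
  have ha : ∀ i, i ≠ c → a i + degIn (pathGraph s) Finset.univ i = 2 := fun i hi => by
    have := h2 i
    have := htwo i hi.symm
    omega
  rcases hc.eq_or_lt with h3 | h4
  · refine (hsp.card_copies_of_three hS ?_ hG hV ha h3.symm).trans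
      (Nat.mul_le_mul_right _ (by norm_num))
    by_contra hs4
    have hcard := hsp.card hS
    have hle : ∑ i, a i ≤ ∑ _i : Fin s, 2 := Finset.sum_le_sum fun i _ => by
      have := degIn_pathGraph_pos hs i
      by_cases hi : i = c
      · subst hi; omega
      · have := ha i hi; omega
    simp only [Finset.sum_const, Finset.card_univ, Fintype.card_fin, smul_eq_mul] at hle
    omega
  · exact (hsp.card_copies_of_single hS hs hG hV ha h4).trans
      (Nat.mul_le_mul_right _ (by norm_num))

theorem embCount_eq_card : embCount G S (Fintype.card W) = (copies G S).card := by
  rw [embCount, ← Set.ncard_coe_finset]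
  congr 1
  ext X
  simp [copies]

theorem subtreeCount_eq_card (hS : S.Connected) :
    subtreeCount G (Fintype.card W) = (copies G S).card + (others G S).card := by
  classical
  have h1 : subtreeCount G (Fintype.card W) = (Finset.univ.filter fun X : Finset V =>
      X.card = Fintype.card W ∧ (G.induce (X : Set V)).Connected).card := by
    rw [subtreeCount, ← Set.ncard_coe_finset]
    congr 1
    ext X
    simp
  rw [h1, ← Finset.card_filter_add_card_filter_not
    (p := fun X : Finset V => Nonempty (G.induce (X : Set V) ≃g S)), Finset.filter_filter,
    Finset.filter_filter]
  congr 2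
  · ext X
    simp only [Finset.mem_filter, Finset.mem_univ, true_and, copies]
    exact ⟨fun h => ⟨h.1.1, h.2⟩, fun h => ⟨⟨h.1, h.2.some.connected_iff.2 hS⟩, h.2⟩⟩

theorem IsCaterpillar.density_le (hcat : IsCaterpillar S) (h17 : 17 ≤ Fintype.card W)
    (hstar : ¬ IsStarlike S) (hpath : ¬ IsPathlike S) (hG : G.IsTree)
    (hV : 8 * Fintype.card W < Fintype.card V) :
    density S G ≤ 1 - (1 / 10 : ℝ) ^ 4 := by
  have h := hcat.card_copies_le h17 hstar hpath hG hV
  rw [density, embCount_eq_card, subtreeCount_eq_card hcat.1.connected]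
  have h' : ((copies G S).card : ℝ) ≤ 9999 * (others G S).card := by exact_mod_cast h
  refine div_le_of_le_mul₀ (by positivity) (by norm_num) ?_
  push_cast
  linarith

end Spine

/-- Every caterpillar with at least 17 vertices that is neither a star nor a
path has inducibility at most 1 - 10^(-4). -/
theorem caterpillar_inducibility_le {W : Type*} [Fintype W]
    (S : SimpleGraph W) (hcat : IsCaterpillar S) (h17 : 17 ≤ Fintype.card W)
    (hstar : ¬ IsStarlike S) (hpath : ¬ IsPathlike S) :
    inducibility S ≤ 1 - (1 / 10 : ℝ) ^ 4 := by
  refine limsup_le_of_le ?_ ?_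
  · refine IsBoundedUnder.isCoboundedUnder_le (isBoundedUnder_of ⟨0, fun n => ?_⟩)
    refine Real.sSup_nonneg ?_
    rintro x ⟨T, -, rfl⟩
    exact div_nonneg (Nat.cast_nonneg _) (Nat.cast_nonneg _)
  · filter_upwards [eventually_gt_atTop (8 * Fintype.card W)] with n hn
    refine Real.sSup_le ?_ (by norm_num)
    rintro x ⟨T, hT, rfl⟩
    exact hcat.density_le h17 hstar hpath hT (by rwa [Fintype.card_fin])
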